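/- arXiv:1402.4199 — 9 statements merged into one kernel-verified Lean document; each statement's English description precedes it below -/
import Mathlib

section
/- Let t be a natural number with 2t ≤ n, let C = {0,1}^n, let ℓ be the function on C defined by ℓ(x) = t − (x_1+…+x_n), and let f : C → ℝ be invariant under all permutations of the coordinates, with deg_C(f) ≤ t. Suppose ℓ properly divides f to odd order. Then for every natural number d ≤ t, the function f is not d-sos on C. -/
/-- The hypercube `{0,1}^n ⊆ ℝ^n`. -/
def cube (n : ℕ) : Set (Fin n → ℝ) := {x | ∀ i, x i = 0 ∨ x i = 1}

/-- `f` is `k`-sos on `X`: a finite sum of squares of polynomials of total degree ≤ `k`,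
as a function on `X`. -/
def IsSosOn (n : ℕ) (X : Set (Fin n → ℝ)) (k : ℕ) (f : (Fin n → ℝ) → ℝ) : Prop :=
  ∃ (m : ℕ) (g : Fin m → MvPolynomial (Fin n) ℝ),
    (∀ i, (g i).totalDegree ≤ k) ∧ ∀ x ∈ X, f x = ∑ i, (MvPolynomial.eval x (g i)) ^ 2

/-- The degree of `f` as a function on `X`: the minimal total degree of a polynomial
restricting to `f` on `X`. -/
noncomputable def degOn (n : ℕ) (X : Set (Fin n → ℝ)) (f : (Fin n → ℝ) → ℝ) : ℕ :=
  sInf {d | ∃ p : MvPolynomial (Fin n) ℝ, p.totalDegree ≤ d ∧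
    ∀ x ∈ X, MvPolynomial.eval x p = f x}

/-- `g` properly divides `f` on `X`: `f = g·h` on `X` with `deg f = deg g + deg h`. -/
def ProperlyDividesOn (n : ℕ) (X : Set (Fin n → ℝ)) (g f : (Fin n → ℝ) → ℝ) : Prop :=
  ∃ h : (Fin n → ℝ) → ℝ, (∀ x ∈ X, f x = g x * h x) ∧
    degOn n X f = degOn n X g + degOn n X h

/-- `f` is invariant under all permutations of coordinates, as a function on `X`. -/
def SymmOn (n : ℕ) (X : Set (Fin n → ℝ)) (f : (Fin n → ℝ) → ℝ) : Prop :=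
  ∀ σ : Equiv.Perm (Fin n), ∀ x ∈ X, f (fun i => x (σ i)) = f x

namespace Hypercube

open Finset Polynomial
open scoped Pointwise

/-- The inclusion matrix between `d`-subsets and `t`-subsets of `U` has trivial kernel when
`d ≤ t ≤ |U| - d`. -/
lemma eq_zero_of_sum_powersetCard_eq_zero {α : Type*} [DecidableEq α] (d : ℕ) :
    ∀ (t : ℕ) (U : Finset α) (b : Finset α → ℝ), d ≤ t → d + t ≤ #U →
      (∀ A ⊆ U, #A = t → ∑ S ∈ A.powersetCard d, b S = 0) →
      ∀ S ⊆ U, #S = d → b S = 0 := by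
  induction d with
  | zero =>
    intro t U b _ htU hb S _ hS
    obtain ⟨A, hAU, hA⟩ := exists_subset_card_eq (show t ≤ #U by omega)
    have := hb A hAU hA
    rw [card_eq_zero.mp hS]
    simpa using this
  | succ d ih =>
    intro t U b hdt htU hb
    obtain ⟨t, rfl⟩ : ∃ t', t = t' + 1 := ⟨t - 1, by omega⟩
    have sum_insert_eq : ∀ (i : α) (A : Finset α), i ∉ A →
        ∑ S ∈ (insert i A).powersetCard (d + 1), b S =
          ∑ S ∈ A.powersetCard (d + 1), b S + ∑ S ∈ A.powersetCard d, b (insert i S) := by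
      intro i A hi
      rw [powersetCard_succ_insert hi, sum_union, sum_image]
      · intro S hS T hT h
        have hS' : i ∉ S := fun h => hi ((mem_powersetCard.mp hS).1 h)
        have hT' : i ∉ T := fun h => hi ((mem_powersetCard.mp hT).1 h)
        rw [← erase_insert hS', ← erase_insert hT', h]
      · rw [Finset.disjoint_left]
        intro S hS hS'
        obtain ⟨T, -, rfl⟩ := mem_image.mp hS'
        exact hi ((mem_powersetCard.mp hS).1 (mem_insert_self i T))
    have swap_eq : ∀ i ∈ U, ∀ j ∈ U, i ≠ j → ∀ S ⊆ (U.erase i).erase j, #S = d →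
        b (insert i S) = b (insert j S) := by
      intro i hi j hj hij S hS hSd
      refine sub_eq_zero.mp (ih t ((U.erase i).erase j) (fun S => b (insert i S) - b (insert j S))
        (by omega) ?_ ?_ S hS hSd)
      · rw [card_erase_of_mem (mem_erase.mpr ⟨hij.symm, hj⟩), card_erase_of_mem hi]
        omega
      · intro A hA hAt
        have hiA : i ∉ A := fun h => by simpa using hA h
        have hjA : j ∉ A := fun h => by simpa using hA h
        have hAU : A ⊆ U := hA.trans ((erase_subset _ _).trans (erase_subset _ _))
        have h1 := hb (insert i A) (insert_subset hi hAU) (by rw [card_insert_of_notMem hiA, hAt])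
        have h2 := hb (insert j A) (insert_subset hj hAU) (by rw [card_insert_of_notMem hjA, hAt])
        rw [sum_insert_eq i A hiA] at h1
        rw [sum_insert_eq j A hjA] at h2
        rw [sum_sub_distrib]
        linarith
    have all_eq : ∀ m : ℕ, ∀ S ⊆ U, ∀ T ⊆ U, #S = d + 1 → #T = d + 1 → #(S \ T) = m →
        b S = b T := by
      intro m
      induction m with
      | zero =>
        intro S _ T _ hS hT h
        have : S ⊆ T := by rwa [card_eq_zero, sdiff_eq_empty_iff_subset] at h
        rw [eq_of_subset_of_card_le this (by omega)]
      | succ m ihm =>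
        intro S hSU T hTU hS hT h
        obtain ⟨i, hi⟩ : (S \ T).Nonempty := card_pos.mp (by omega)
        obtain ⟨j, hj⟩ : (T \ S).Nonempty := by
          apply card_pos.mp
          have h1 := card_sdiff_add_card_inter S T
          have h2 := card_sdiff_add_card_inter T S
          rw [inter_comm] at h2
          omega
        rw [mem_sdiff] at hi hj
        have hij : i ≠ j := fun h => hj.2 (h ▸ hi.1)
        have hjS : j ∉ S.erase i := fun h => hj.2 (mem_of_mem_erase h)
        have hcard : #(S.erase i) = d := by rw [card_erase_of_mem hi.1, hS]; omega
        have h1 := swap_eq i (hSU hi.1) j (hTU hj.1) hij (S.erase i)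
          (fun x hx => by
            rw [mem_erase, mem_erase]
            exact ⟨fun h => hjS (h ▸ hx), (mem_erase.mp hx).1, hSU (mem_of_mem_erase hx)⟩) hcard
        rw [insert_erase hi.1] at h1
        rw [h1]
        refine ihm _ (insert_subset (hTU hj.1) ((erase_subset _ _).trans hSU)) T hTU
          (by rw [card_insert_of_notMem hjS, hcard]) hT ?_
        have : insert j (S.erase i) \ T = (S \ T).erase i := by
          ext x
          simp only [mem_sdiff, mem_insert, mem_erase]
          grind
        rw [this, card_erase_of_mem (mem_sdiff.mpr hi), h]
        omega
    intro S hSU hS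
    obtain ⟨A, hSA, hAU, hA⟩ := exists_subsuperset_card_eq hSU (show #S ≤ t + 1 by omega)
      (by omega)
    have h1 := hb A hAU hA
    rw [sum_congr rfl (fun T hT => all_eq _ T ((mem_powersetCard.mp hT).1.trans hAU) S hSU
      (mem_powersetCard.mp hT).2 hS rfl), sum_const, card_powersetCard, hA, nsmul_eq_mul] at h1
    refine (mul_eq_zero.mp h1).resolve_left ?_
    exact_mod_cast (Nat.choose_pos hdt).ne'

variable {n : ℕ}

/-- The squarefree monomial `∏_{i ∈ S} x_i` as a function on subsets. -/
def monomialFn (S A : Finset (Fin n)) : ℝ := if S ⊆ A then 1 else 0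

/-- The functions on the cube represented by polynomials of degree `< k`. -/
def lowDegree (n k : ℕ) : Submodule ℝ (Finset (Fin n) → ℝ) :=
  Submodule.span ℝ (monomialFn '' {S | #S < k})

lemma monomialFn_mem {k : ℕ} {S : Finset (Fin n)} (hS : #S < k) :
    monomialFn S ∈ lowDegree n k :=
  Submodule.subset_span ⟨S, hS, rfl⟩

lemma lowDegree_zero : lowDegree n 0 = ⊥ := by simp [lowDegree]

lemma lowDegree_mono {k l : ℕ} (h : k ≤ l) : lowDegree n k ≤ lowDegree n l :=
  Submodule.span_mono (Set.image_mono fun _ hS => lt_of_lt_of_le hS h)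

lemma mul_mem_lowDegree {k l : ℕ} {φ ψ : Finset (Fin n) → ℝ} (hφ : φ ∈ lowDegree n k)
    (hψ : ψ ∈ lowDegree n l) : φ * ψ ∈ lowDegree n (k + l - 1) := by
  have h := Submodule.mul_mem_mul hφ hψ
  rw [lowDegree, lowDegree, Submodule.span_mul_span] at h
  refine Submodule.span_mono ?_ h
  rintro _ ⟨_, ⟨S, hS, rfl⟩, _, ⟨T, hT, rfl⟩, rfl⟩
  refine ⟨S ∪ T, ?_, ?_⟩
  · have := card_union_le S T
    simp only [Set.mem_ofPred_eq] at *
    omega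
  · ext A
    by_cases hSA : S ⊆ A <;> by_cases hTA : T ⊆ A <;> simp [monomialFn, union_subset_iff, hSA, hTA]

lemma card_mul_monomialFn (S A : Finset (Fin n)) :
    (#A : ℝ) * monomialFn S A = #S * monomialFn S A + ∑ j ∈ Sᶜ, monomialFn (insert j S) A := by
  by_cases h : S ⊆ A
  · have h1 : ∑ j ∈ Sᶜ, monomialFn (insert j S) A = #(A \ S) := by
      simp only [monomialFn, insert_subset_iff, h, and_true]
      rw [sum_boole]
      congr 2
      ext x
      simp [and_comm]
    have h2 : (#(A \ S) : ℝ) + #S = #A := by exact_mod_cast card_sdiff_add_card_eq_card h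
    rw [h1]
    simp only [monomialFn, h, if_true]
    linarith
  · simp [monomialFn, insert_subset_iff, h]

/-- The functions of the form `(t - |A|) φ(A) + ψ(A)` with `φ` of degree `< d` and `ψ`
homogeneous of degree `d`. -/
def divisionSpace (n t d : ℕ) : Submodule ℝ (Finset (Fin n) → ℝ) where
  carrier := {φ | ∃ h ∈ lowDegree n d, ∃ b : Finset (Fin n) → ℝ, ∀ A,
    φ A = ((t : ℝ) - #A) * h A + ∑ S ∈ A.powersetCard d, b S}
  zero_mem' := ⟨0, zero_mem _, 0, by simp⟩
  add_mem' := by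
    rintro φ ψ ⟨h, hh, b, hb⟩ ⟨h', hh', b', hb'⟩
    refine ⟨h + h', add_mem hh hh', b + b', fun A => ?_⟩
    simp only [Pi.add_apply, hb, hb', sum_add_distrib]
    ring
  smul_mem' := by
    rintro r φ ⟨h, hh, b, hb⟩
    refine ⟨r • h, Submodule.smul_mem _ _ hh, r • b, fun A => ?_⟩
    simp only [Pi.smul_apply, smul_eq_mul, hb, ← mul_sum]
    ring

lemma monomialFn_mem_divisionSpace {t d : ℕ} (hdt : d ≤ t) (m : ℕ) :
    ∀ S : Finset (Fin n), #S + m = d → monomialFn S ∈ divisionSpace n t d := by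
  induction m with
  | zero =>
    intro S hS
    refine ⟨0, zero_mem _, fun T => if T = S then 1 else 0, fun A => ?_⟩
    have : S ∈ A.powersetCard d ↔ S ⊆ A := by
      rw [mem_powersetCard, and_iff_left (by omega)]
    simp [monomialFn, this]
  | succ m ih =>
    intro S hS
    have hts : (t : ℝ) - #S ≠ 0 := by
      have : (#S : ℝ) < t := by exact_mod_cast (by omega : #S < t)
      linarith
    have hmul : (fun A => ((t : ℝ) - #A) * monomialFn S A) ∈ divisionSpace n t d :=
      ⟨monomialFn S, monomialFn_mem (by omega), 0, by simp⟩
    have hsum : ∑ j ∈ Sᶜ, monomialFn (insert j S) ∈ divisionSpace n t d :=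
      sum_mem fun j hj => ih _ (by rw [card_insert_of_notMem (mem_compl.mp hj)]; omega)
    have heq : monomialFn S = ((t : ℝ) - #S)⁻¹ •
        ((fun A => ((t : ℝ) - #A) * monomialFn S A) + ∑ j ∈ Sᶜ, monomialFn (insert j S)) := by
      ext A
      simp only [Pi.smul_apply, Pi.add_apply, Finset.sum_apply, smul_eq_mul]
      rw [eq_inv_mul_iff_mul_eq₀ hts]
      linarith [card_mul_monomialFn S A]
    rw [heq]
    exact Submodule.smul_mem _ _ (add_mem hmul hsum)

/-- A function of degree `≤ d ≤ t ≤ n - d` vanishing on the `t`-th slice is divisible by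
`t - |A|`, with a quotient of smaller degree. -/
lemma exists_eq_mul_of_vanish {t d : ℕ} (hdt : d ≤ t) (hn : d + t ≤ n)
    {φ : Finset (Fin n) → ℝ} (hφ : φ ∈ lowDegree n (d + 1)) (h0 : ∀ A, #A = t → φ A = 0) :
    ∃ h ∈ lowDegree n d, ∀ A, φ A = ((t : ℝ) - #A) * h A := by
  have hle : lowDegree n (d + 1) ≤ divisionSpace n t d := by
    refine Submodule.span_le.mpr ?_
    rintro _ ⟨S, hS, rfl⟩
    have : #S < d + 1 := hS
    exact monomialFn_mem_divisionSpace hdt (d - #S) S (by omega)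
  obtain ⟨h, hh, b, hb⟩ := hle hφ
  have hb0 := eq_zero_of_sum_powersetCard_eq_zero d t univ b hdt (by simpa using hn)
    (fun A _ hA => by simpa [h0 A hA, hA] using (hb A).symm)
  refine ⟨h, hh, fun A => ?_⟩
  rw [hb, sum_eq_zero fun S hS => hb0 S (subset_univ S) (mem_powersetCard.mp hS).2, add_zero]

lemma monomialFn_smul (σ : Equiv.Perm (Fin n)) (S A : Finset (Fin n)) :
    monomialFn (σ • S) (σ • A) = monomialFn S A := by
  simp [monomialFn]

/-- The sum over all permutations of a function of degree `< k` is a univariate polynomial of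
degree `< k` in `|A|`. -/
lemma exists_poly_sum_perm {k : ℕ} {φ : Finset (Fin n) → ℝ} (hφ : φ ∈ lowDegree n k) :
    ∃ R : ℝ[X], R.degree < k ∧
      ∀ A, ∑ σ : Equiv.Perm (Fin n), φ (σ • A) = R.eval (#A : ℝ) := by
  have hmono : ∀ S : Finset (Fin n), ∃ R : ℝ[X], R.natDegree ≤ #S ∧
      ∀ A, ∑ σ : Equiv.Perm (Fin n), monomialFn S (σ • A) = R.eval (#A : ℝ) := by
    intro S
    induction S using Finset.induction_on with
    | empty =>
      exact ⟨C (Fintype.card (Equiv.Perm (Fin n)) : ℝ), by simp, fun A => by simp [monomialFn]⟩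
    | insert i S hi ih =>
      obtain ⟨R, hR, hRA⟩ := ih
      have hne : (#Sᶜ : ℝ) ≠ 0 := by
        exact_mod_cast (card_pos.mpr ⟨i, mem_compl.mpr hi⟩).ne'
      refine ⟨C (#Sᶜ : ℝ)⁻¹ * ((X - C (#S : ℝ)) * R), ?_, fun A => ?_⟩
      · refine (natDegree_C_mul_le _ _).trans (natDegree_mul_le.trans ?_)
        rw [natDegree_X_sub_C, card_insert_of_notMem hi]
        omega
      · have hswap : ∀ j ∈ Sᶜ, ∑ σ : Equiv.Perm (Fin n), monomialFn (insert j S) (σ • A) =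
            ∑ σ : Equiv.Perm (Fin n), monomialFn (insert i S) (σ • A) := by
          intro j hj
          rw [mem_compl] at hj
          have hS : insert j S = Equiv.swap i j • insert i S := by
            rw [smul_finset_insert, Equiv.Perm.smul_def, Equiv.swap_apply_left]
            congr 1
            symm
            refine (image_congr ?_).trans image_id
            intro x hx
            exact Equiv.swap_apply_of_ne_of_ne (fun h => hi (h ▸ hx)) (fun h => hj (h ▸ hx))
          rw [hS, ← Equiv.sum_comp (Equiv.mulLeft (Equiv.swap i j))]
          refine sum_congr rfl fun σ _ => ?_
          rw [Equiv.coe_mulLeft, mul_smul, monomialFn_smul]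
        have h1 : ∑ σ : Equiv.Perm (Fin n), (#A : ℝ) * monomialFn S (σ • A) =
            #S * R.eval (#A : ℝ) +
              #Sᶜ * ∑ σ : Equiv.Perm (Fin n), monomialFn (insert i S) (σ • A) := by
          rw [← hRA, mul_sum, ← nsmul_eq_mul, ← sum_const, ← sum_congr rfl hswap, sum_comm,
            ← sum_add_distrib]
          refine sum_congr rfl fun σ _ => ?_
          rw [← card_mul_monomialFn, card_smul_finset]
        rw [← mul_sum, hRA] at h1
        simp only [eval_mul, eval_C, eval_sub, eval_X]
        rw [eq_inv_mul_iff_mul_eq₀ hne]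
        linarith
  induction hφ using Submodule.span_induction with
  | mem φ hφ =>
    obtain ⟨S, hS, rfl⟩ := hφ
    obtain ⟨R, hR, hRA⟩ := hmono S
    refine ⟨R, degree_le_natDegree.trans_lt ?_, hRA⟩
    exact_mod_cast lt_of_le_of_lt hR hS
  | zero => exact ⟨0, by simp [bot_lt_iff_ne_bot], by simp⟩
  | add φ ψ _ _ h1 h2 =>
    obtain ⟨R, hR, hRA⟩ := h1
    obtain ⟨R', hR', hRA'⟩ := h2
    exact ⟨R + R', (degree_add_le _ _).trans_lt (max_lt hR hR'), fun A => by
      simp [sum_add_distrib, hRA, hRA']⟩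
  | smul r φ _ h1 =>
    obtain ⟨R, hR, hRA⟩ := h1
    exact ⟨r • R, (degree_smul_le _ _).trans_lt hR, fun A => by
      simp [← mul_sum, hRA]⟩

/-- Two polynomials of degree `≤ n` which agree at `0, …, n` are equal. -/
lemma poly_ext {P Q : ℝ[X]} (hP : P.natDegree ≤ n) (hQ : Q.natDegree ≤ n)
    (h : ∀ A : Finset (Fin n), P.eval (#A : ℝ) = Q.eval (#A : ℝ)) : P = Q := by
  have hcard : #((range (n + 1)).image (Nat.cast : ℕ → ℝ)) = n + 1 := by
    rw [card_image_of_injective _ Nat.cast_injective, card_range]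
  have hlt : ∀ {P : ℝ[X]}, P.natDegree ≤ n → P.degree < (n + 1 : ℕ) := fun hP =>
    degree_le_natDegree.trans_lt (by exact_mod_cast Nat.lt_succ_of_le hP)
  refine eq_of_degrees_lt_of_eval_finset_eq ((range (n + 1)).image (Nat.cast : ℕ → ℝ))
    (by rw [hcard]; exact hlt hP) (by rw [hcard]; exact hlt hQ) ?_
  intro x hx
  obtain ⟨k, hk, rfl⟩ := mem_image.mp hx
  obtain ⟨A, -, rfl⟩ := exists_subset_card_eq
    (show k ≤ #(univ : Finset (Fin n)) by simpa using Nat.lt_succ_iff.mp (mem_range.mp hk))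
  exact h A

lemma smul_mem_lowDegree {k : ℕ} {φ : Finset (Fin n) → ℝ} (σ : Equiv.Perm (Fin n))
    (hφ : φ ∈ lowDegree n k) : (fun A => φ (σ • A)) ∈ lowDegree n k := by
  have hle : lowDegree n k ≤ (lowDegree n k).comap (LinearMap.funLeft ℝ ℝ (σ • ·)) := by
    refine Submodule.span_le.mpr ?_
    rintro _ ⟨S, hS, rfl⟩
    have heq : LinearMap.funLeft ℝ ℝ (σ • ·) (monomialFn S) = monomialFn (σ⁻¹ • S) := by
      ext A
      rw [LinearMap.funLeft_apply, ← monomialFn_smul σ⁻¹, inv_smul_smul]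
    change LinearMap.funLeft ℝ ℝ (σ • ·) (monomialFn S) ∈ lowDegree n k
    rw [heq]
    exact monomialFn_mem (by rwa [card_smul_finset])
  exact hle hφ

/-- A symmetric sum of squares of polynomials of degree `< k ≤ t + 1` vanishes to even order
at `t`. -/
lemma even_rootMultiplicity {t : ℕ} (ht : 2 * t ≤ n) (k : ℕ) :
    ∀ (F : ℝ[X]) (ι : Type) [Fintype ι] (g : ι → Finset (Fin n) → ℝ), k ≤ t + 1 → F ≠ 0 →
      F.natDegree ≤ n → (∀ i, g i ∈ lowDegree n k) →
      (∀ A : Finset (Fin n), F.eval (#A : ℝ) = ∑ i, g i A ^ 2) →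
      Even (F.rootMultiplicity (t : ℝ)) := by
  induction k with
  | zero =>
    intro F ι _ g _ hF hFn hg hFg
    refine absurd (poly_ext hFn (by simp) fun A => ?_) hF
    have : ∀ i, g i = 0 := fun i => by simpa [lowDegree_zero] using hg i
    simp [hFg, this]
  | succ k ih =>
    intro F ι _ g hk hF hFn hg hFg
    by_cases hroot : F.eval (t : ℝ) = 0
    swap
    · rw [rootMultiplicity_eq_zero hroot]
      exact Even.zero
    have hvanish : ∀ i, ∀ A, #A = t → g i A = 0 := by
      intro i A hA
      have h := hFg A
      rw [hA, hroot, eq_comm, sum_eq_zero_iff_of_nonneg fun i _ => sq_nonneg _] at h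
      simpa using h i (mem_univ i)
    choose h hh hgh using fun i =>
      exists_eq_mul_of_vanish (show k ≤ t by omega) (by omega) (hg i) (hvanish i)
    have hFh : ∀ A : Finset (Fin n),
        F.eval (#A : ℝ) = ((t : ℝ) - #A) ^ 2 * ∑ i, h i A ^ 2 := by
      intro A
      rw [hFg, mul_sum]
      exact sum_congr rfl fun i _ => by rw [hgh, mul_pow]
    have hmem : (∑ i, h i * h i) ∈ lowDegree n (k + k - 1) :=
      sum_mem fun i _ => mul_mem_lowDegree (hh i) (hh i)
    obtain ⟨R, hR, hRA⟩ := exists_poly_sum_perm hmem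
    have hRsum : ∀ A : Finset (Fin n),
        R.eval (#A : ℝ) = ∑ p : Equiv.Perm (Fin n) × ι, h p.2 (p.1 • A) ^ 2 := by
      intro A
      rw [← hRA, Fintype.sum_prod_type]
      simp [Finset.sum_apply, sq]
    set N : ℝ := ((Fintype.card (Equiv.Perm (Fin n)) : ℕ) : ℝ) with hN
    have hN0 : N ≠ 0 := by rw [hN]; exact_mod_cast Fintype.card_ne_zero
    have hRdeg : R = 0 ∨ R.natDegree + 2 ≤ n := by
      by_cases hR0 : R = 0
      · exact Or.inl hR0
      · right
        rw [degree_eq_natDegree hR0] at hR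
        have : R.natDegree < k + k - 1 := by exact_mod_cast hR
        omega
    have heq : C N * F = (X - C (t : ℝ)) ^ 2 * R := by
      refine poly_ext ((natDegree_C_mul_le _ _).trans hFn) ?_ fun A => ?_
      · rcases hRdeg with rfl | hRdeg
        · simp
        · refine natDegree_mul_le.trans ?_
          rw [natDegree_pow, natDegree_X_sub_C]
          omega
      · simp only [eval_mul, eval_C, eval_pow, eval_sub, eval_X]
        have : N * F.eval (#A : ℝ) = ∑ σ : Equiv.Perm (Fin n), F.eval (#(σ • A) : ℝ) := by
          simp [card_smul_finset, hN]
        rw [this, hRsum, Fintype.sum_prod_type, mul_sum]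
        refine sum_congr rfl fun σ _ => ?_
        rw [hFh, card_smul_finset]
        ring
    have hne : C N * F ≠ 0 := mul_ne_zero (C_ne_zero.mpr hN0) hF
    have hR0 : R ≠ 0 := by
      rintro rfl
      exact hne (by rw [heq, mul_zero])
    have hmult : F.rootMultiplicity (t : ℝ) = 2 + R.rootMultiplicity (t : ℝ) := by
      have h1 := congrArg (rootMultiplicity (t : ℝ)) heq
      rwa [rootMultiplicity_mul hne, rootMultiplicity_mul (heq ▸ hne), rootMultiplicity_C,
        zero_add, rootMultiplicity_X_sub_C_pow] at h1
    rw [hmult]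
    exact even_two.add (ih R (Equiv.Perm (Fin n) × ι) (fun p A => h p.2 (p.1 • A)) (by omega) hR0
      (by have := hRdeg.resolve_left hR0; omega)
      (fun p => smul_mem_lowDegree p.1 (hh p.2)) hRsum)

/-- The vertex of the cube with support `A`. -/
def vertex (A : Finset (Fin n)) : Fin n → ℝ := fun i => if i ∈ A then 1 else 0

lemma vertex_mem_cube (A : Finset (Fin n)) : vertex A ∈ cube n := fun i => by
  by_cases h : i ∈ A <;> simp [vertex, h]

lemma exists_eq_vertex {x : Fin n → ℝ} (hx : x ∈ cube n) : ∃ A, x = vertex A := by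
  classical
  refine ⟨univ.filter fun i => x i = 1, funext fun i => ?_⟩
  rcases hx i with h | h <;> simp [vertex, h]

lemma sum_vertex (A : Finset (Fin n)) : ∑ i, vertex A i = #A := by simp [vertex]

lemma vertex_smul (σ : Equiv.Perm (Fin n)) (A : Finset (Fin n)) :
    vertex (σ • A) = fun i => vertex A (σ⁻¹ i) := by
  ext i
  simp only [vertex, ← inv_smul_mem_iff, Equiv.Perm.smul_def]

lemma eval_mem_lowDegree {k : ℕ} {p : MvPolynomial (Fin n) ℝ} (hp : p.totalDegree ≤ k) :
    (fun A => MvPolynomial.eval (vertex A) p) ∈ lowDegree n (k + 1) := by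
  have heq : (fun A => MvPolynomial.eval (vertex A) p) =
      ∑ m ∈ p.support, p.coeff m • monomialFn m.support := by
    ext A
    simp only [MvPolynomial.eval_eq, Finset.sum_apply, Pi.smul_apply, smul_eq_mul]
    refine sum_congr rfl fun m _ => ?_
    congr 1
    by_cases h : m.support ⊆ A
    · rw [monomialFn, if_pos h]
      exact prod_eq_one fun i hi => by simp [vertex, h hi]
    · rw [monomialFn, if_neg h]
      obtain ⟨i, hi, hiA⟩ := not_subset.mp h
      exact prod_eq_zero hi (by simp [vertex, hiA, Finsupp.mem_support_iff.mp hi])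
  rw [heq]
  refine sum_mem fun m hm => Submodule.smul_mem _ _ (monomialFn_mem ?_)
  have h1 : #m.support ≤ m.sum fun _ e => e := by
    rw [card_eq_sum_ones]
    exact sum_le_sum fun i hi => Nat.one_le_iff_ne_zero.mpr (Finsupp.mem_support_iff.mp hi)
  have h2 := MvPolynomial.le_totalDegree hm
  omega

lemma exists_mvPolynomial {k : ℕ} {φ : Finset (Fin n) → ℝ} (hφ : φ ∈ lowDegree n (k + 1)) :
    ∃ p : MvPolynomial (Fin n) ℝ, p.totalDegree ≤ k ∧
      ∀ A, MvPolynomial.eval (vertex A) p = φ A := by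
  induction hφ using Submodule.span_induction with
  | mem φ hφ =>
    obtain ⟨S, hS, rfl⟩ := hφ
    refine ⟨∏ i ∈ S, MvPolynomial.X i, ?_, fun A => ?_⟩
    · refine (MvPolynomial.totalDegree_finsetProd _ _).trans ?_
      simp only [MvPolynomial.totalDegree_X, sum_const, smul_eq_mul, mul_one]
      exact Nat.lt_succ_iff.mp hS
    · simp [vertex, monomialFn, prod_ite_zero, subset_iff]
  | zero => exact ⟨0, by simp, by simp⟩
  | add φ ψ _ _ h1 h2 =>
    obtain ⟨p, hp, hpA⟩ := h1
    obtain ⟨q, hq, hqA⟩ := h2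
    exact ⟨p + q, (MvPolynomial.totalDegree_add _ _).trans (max_le hp hq), fun A => by
      simp [hpA, hqA]⟩
  | smul r φ _ h1 =>
    obtain ⟨p, hp, hpA⟩ := h1
    exact ⟨r • p, (MvPolynomial.totalDegree_smul_le _ _).trans hp, fun A => by
      simp [MvPolynomial.smul_eval, hpA]⟩

/-- Every function on the cube is a polynomial. -/
lemma exists_mvPolynomial_eq (φ : Finset (Fin n) → ℝ) :
    ∃ p : MvPolynomial (Fin n) ℝ, ∀ A, MvPolynomial.eval (vertex A) p = φ A := by
  refine ⟨∑ B, MvPolynomial.C (φ B) *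
    ∏ i, if i ∈ B then MvPolynomial.X i else 1 - MvPolynomial.X i, fun A => ?_⟩
  rw [map_sum, sum_eq_single A]
  · rw [map_mul, MvPolynomial.eval_C, map_prod, prod_eq_one, mul_one]
    intro i _
    by_cases h : i ∈ A <;> simp [h, vertex]
  · intro B _ hBA
    obtain ⟨i, hi⟩ : ∃ i, ¬(i ∈ B ↔ i ∈ A) := by
      by_contra! h
      exact hBA (Finset.ext h)
    rw [map_mul, map_prod, prod_eq_zero (mem_univ i), mul_zero]
    by_cases h : i ∈ B <;> by_cases h' : i ∈ A <;> simp_all [vertex]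
  · simp

lemma degOn_le_iff {f : (Fin n → ℝ) → ℝ} {k : ℕ} :
    degOn n (cube n) f ≤ k ↔ (fun A => f (vertex A)) ∈ lowDegree n (k + 1) := by
  constructor
  · intro h
    obtain ⟨p, hp⟩ := exists_mvPolynomial_eq fun A => f (vertex A)
    have hne : {d | ∃ p : MvPolynomial (Fin n) ℝ, p.totalDegree ≤ d ∧
        ∀ x ∈ cube n, MvPolynomial.eval x p = f x}.Nonempty := by
      refine ⟨p.totalDegree, p, le_rfl, fun x hx => ?_⟩
      obtain ⟨A, rfl⟩ := exists_eq_vertex hx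
      exact hp A
    obtain ⟨q, hq, hqf⟩ := Nat.sInf_mem hne
    have : (fun A => f (vertex A)) = fun A => MvPolynomial.eval (vertex A) q :=
      funext fun A => (hqf _ (vertex_mem_cube A)).symm
    rw [this]
    exact eval_mem_lowDegree (hq.trans h)
  · intro h
    obtain ⟨p, hp, hpf⟩ := exists_mvPolynomial h
    refine Nat.sInf_le ⟨p, hp, fun x hx => ?_⟩
    obtain ⟨A, rfl⟩ := exists_eq_vertex hx
    exact hpf A

lemma eval_card_mem_lowDegree (F : ℝ[X]) :
    (fun A : Finset (Fin n) => F.eval (#A : ℝ)) ∈ lowDegree n (F.natDegree + 1) := by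
  have hone : (1 : Finset (Fin n) → ℝ) ∈ lowDegree n 1 := by
    have : (1 : Finset (Fin n) → ℝ) = monomialFn ∅ := by ext A; simp [monomialFn]
    exact this ▸ monomialFn_mem (by simp)
  have hcard : (fun A : Finset (Fin n) => (#A : ℝ)) ∈ lowDegree n 2 := by
    have : (fun A : Finset (Fin n) => (#A : ℝ)) = ∑ i, monomialFn {i} := by
      ext A; simp [monomialFn, Finset.sum_apply]
    rw [this]
    exact sum_mem fun i _ => monomialFn_mem (by simp)
  have hpow : ∀ j, (fun A : Finset (Fin n) => (#A : ℝ)) ^ j ∈ lowDegree n (j + 1) := by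
    intro j
    induction j with
    | zero => simpa using hone
    | succ j ih =>
      rw [pow_succ]
      exact lowDegree_mono (by omega) (mul_mem_lowDegree ih hcard)
  have heq : (fun A : Finset (Fin n) => F.eval (#A : ℝ)) =
      ∑ j ∈ range (F.natDegree + 1), F.coeff j • (fun A : Finset (Fin n) => (#A : ℝ)) ^ j := by
    ext A
    simp [eval_eq_sum_range, Finset.sum_apply]
  rw [heq]
  exact sum_mem fun j hj => Submodule.smul_mem _ _
    (lowDegree_mono (by have := mem_range.mp hj; omega) (hpow j))

/-- A function of degree `≤ k` invariant under permutations is a univariate polynomial of degree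
`≤ k` in `|A|`. -/
lemma exists_poly_of_symm {k : ℕ} {φ : Finset (Fin n) → ℝ} (hφ : φ ∈ lowDegree n (k + 1))
    (hsymm : ∀ (σ : Equiv.Perm (Fin n)) A, φ (σ • A) = φ A) :
    ∃ F : ℝ[X], F.natDegree ≤ k ∧ ∀ A, φ A = F.eval (#A : ℝ) := by
  obtain ⟨R, hR, hRA⟩ := exists_poly_sum_perm hφ
  have hN0 : (Fintype.card (Equiv.Perm (Fin n)) : ℝ) ≠ 0 := by exact_mod_cast Fintype.card_ne_zero
  refine ⟨C (Fintype.card (Equiv.Perm (Fin n)) : ℝ)⁻¹ * R,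
    (natDegree_C_mul_le _ _).trans ?_, fun A => ?_⟩
  · exact natDegree_le_iff_coeff_eq_zero.mpr fun N hN => (degree_lt_iff_coeff_zero _ _).mp hR N hN
  · rw [eval_mul, eval_C, eq_inv_mul_iff_mul_eq₀ hN0, ← hRA]
    simp only [hsymm, sum_const, card_univ, nsmul_eq_mul]

/-- The degree on the cube of a univariate polynomial in `∑ x_i`. -/
lemma degOn_eq_natDegree {f : (Fin n → ℝ) → ℝ} {F : ℝ[X]} (hF : F.natDegree ≤ n)
    (hf : ∀ A, f (vertex A) = F.eval (#A : ℝ)) : degOn n (cube n) f = F.natDegree := by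
  have hle : degOn n (cube n) f ≤ F.natDegree := by
    rw [degOn_le_iff]
    simpa only [hf] using eval_card_mem_lowDegree F
  refine le_antisymm hle ?_
  obtain ⟨G, hG, hGA⟩ := exists_poly_of_symm (degOn_le_iff.mp (le_refl (degOn n (cube n) f)))
    fun σ A => by simp only [hf, card_smul_finset]
  have : F = G := poly_ext hF (hG.trans (hle.trans hF)) fun A => by rw [← hf, ← hGA]
  rwa [this]

/-- A polynomial of degree `≤ t` agrees with `s ↦ (t - s) ^ c`, `c > t`, at `0, …, 2t` only if
`t ≤ 1`. -/
lemma le_one_of_eval_eq_pow {t c : ℕ} (hct : t < c) {R : ℝ[X]} (hR : R.natDegree ≤ t)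
    (h : ∀ j ≤ 2 * t, R.eval (j : ℝ) = ((j : ℝ) - t) ^ c) : t ≤ 1 := by
  set Q : ℝ[X] := (X - C (t : ℝ)) ^ c - R with hQ
  have hQ0 : Q ≠ 0 := by
    intro h0
    have h1 := congrArg natDegree (sub_eq_zero.mp h0)
    rw [natDegree_pow, natDegree_X_sub_C] at h1
    omega
  have hrolle : ∀ m, #Q.roots.toFinset ≤ #(derivative^[m] Q).roots.toFinset + m := by
    intro m
    induction m with
    | zero => simp
    | succ m ih =>
      have := card_roots_toFinset_le_derivative (derivative^[m] Q)
      rw [Function.iterate_succ_apply']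
      omega
  have hder : #(derivative^[t + 1] Q).roots.toFinset ≤ 1 := by
    rw [hQ, iterate_derivative_sub, iterate_derivative_X_sub_pow,
      iterate_derivative_eq_zero (Nat.lt_succ_of_le hR), sub_zero]
    refine (card_le_card (t := {(t : ℝ)}) fun x hx => ?_).trans (card_singleton _).le
    have hdesc : c.descFactorial (t + 1) ≠ 0 := by
      rw [Ne, Nat.descFactorial_eq_zero_iff_lt]
      omega
    have hx' := isRoot_of_mem_roots (Multiset.mem_toFinset.mp hx)
    simp only [IsRoot, nsmul_eq_mul, eval_mul, eval_natCast, eval_pow, eval_sub, eval_X, eval_C,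
      mul_eq_zero, Nat.cast_eq_zero, hdesc, false_or] at hx'
    rw [mem_singleton]
    linarith [eq_zero_of_pow_eq_zero hx']
  have hroots : 2 * t + 1 ≤ #Q.roots.toFinset := by
    calc 2 * t + 1 = #((range (2 * t + 1)).image (Nat.cast : ℕ → ℝ)) := by
          rw [card_image_of_injective _ Nat.cast_injective, card_range]
      _ ≤ _ := by
          refine card_le_card fun x hx => ?_
          obtain ⟨j, hj, rfl⟩ := mem_image.mp hx
          rw [Multiset.mem_toFinset, mem_roots hQ0, IsRoot, hQ, eval_sub,
            h j (Nat.lt_succ_iff.mp (mem_range.mp hj))]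
          simp
  have := hrolle (t + 1)
  omega

lemma natDegree_const_sub_X_pow (r : ℝ) (c : ℕ) : ((C r - X : ℝ[X]) ^ c).natDegree = c := by
  rw [natDegree_pow, ← neg_sub, natDegree_neg, natDegree_X_sub_C, mul_one]

lemma eval_vertex_pow (t c : ℕ) (A : Finset (Fin n)) :
    ((t : ℝ) - ∑ i, vertex A i) ^ c = ((C (t : ℝ) - X : ℝ[X]) ^ c).eval (#A : ℝ) := by
  simp [sum_vertex]

/-- If an odd power of `t - ∑ x_i` properly divides the zero function, then `n = 0`. -/
lemma eq_zero_of_properlyDividesOn_zero {t c : ℕ} (hodd : Odd c) {f : (Fin n → ℝ) → ℝ}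
    (hf : ∀ A, f (vertex A) = 0)
    (hdiv : ProperlyDividesOn n (cube n) (fun x => ((t : ℝ) - ∑ i, x i) ^ c) f) : n = 0 := by
  obtain ⟨h, -, hdeg⟩ := hdiv
  rw [degOn_eq_natDegree (F := 0) (by simp) (by simpa using hf), natDegree_zero] at hdeg
  have hpow : degOn n (cube n) (fun x => ((t : ℝ) - ∑ i, x i) ^ c) ≤ 0 := by omega
  obtain ⟨F, hF, hFA⟩ := exists_poly_of_symm (degOn_le_iff.mp hpow)
    fun σ A => by simp only [sum_vertex, card_smul_finset]
  rw [eq_C_of_natDegree_le_zero hF] at hFA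
  have h1 := hFA ∅
  have h2 := hFA univ
  simp only [sum_vertex, eval_C] at h1 h2
  have h3 := hodd.strictMono_pow.injective (h1.trans h2.symm)
  have h4 : (n : ℝ) = 0 := by
    rw [card_empty, card_univ, Fintype.card_fin, Nat.cast_zero] at h3
    linarith
  exact_mod_cast h4

/-- If `(t - ∑ x_i) ^ c` properly divides a symmetric function of degree `≤ t ≤ n`, given by a
univariate polynomial `F`, then `c` is at most the order of vanishing of `F` at `t`, provided
`c ≤ t`. -/
lemma le_rootMultiplicity {t c : ℕ} (htn : t ≤ n) (hct : c ≤ t) {f : (Fin n → ℝ) → ℝ} {F : ℝ[X]}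
    (hF0 : F ≠ 0) (hF : F.natDegree ≤ t) (hf : ∀ A, f (vertex A) = F.eval (#A : ℝ))
    (hdiv : ProperlyDividesOn n (cube n) (fun x => ((t : ℝ) - ∑ i, x i) ^ c) f) :
    c ≤ F.rootMultiplicity (t : ℝ) := by
  obtain ⟨h, hfh, hdeg⟩ := hdiv
  rw [degOn_eq_natDegree (hF.trans htn) hf, degOn_eq_natDegree
    (F := (C (t : ℝ) - X) ^ c) (by rw [natDegree_const_sub_X_pow]; omega) (eval_vertex_pow t c),
    natDegree_const_sub_X_pow] at hdeg
  obtain ⟨R, hR, hRA⟩ := exists_poly_sum_perm (degOn_le_iff.mp (le_refl (degOn n (cube n) h)))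
  have hRdeg : R.natDegree ≤ degOn n (cube n) h :=
    natDegree_le_iff_coeff_eq_zero.mpr fun N hN => (degree_lt_iff_coeff_zero _ _).mp hR N hN
  have hN0 : (Fintype.card (Equiv.Perm (Fin n)) : ℝ) ≠ 0 := by exact_mod_cast Fintype.card_ne_zero
  have heq : C (Fintype.card (Equiv.Perm (Fin n)) : ℝ) * F = (C (t : ℝ) - X) ^ c * R := by
    refine poly_ext ((natDegree_C_mul_le _ _).trans (hF.trans htn)) ?_ fun A => ?_
    · refine natDegree_mul_le.trans ?_
      rw [natDegree_const_sub_X_pow]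
      omega
    · have h1 : Fintype.card (Equiv.Perm (Fin n)) * F.eval (#A : ℝ) =
          ∑ σ : Equiv.Perm (Fin n), F.eval (#(σ • A) : ℝ) := by
        simp [card_smul_finset]
      rw [eval_mul, eval_C, h1, eval_mul, ← hRA, mul_sum]
      refine sum_congr rfl fun σ _ => ?_
      rw [← hf, hfh _ (vertex_mem_cube _)]
      beta_reduce
      rw [eval_vertex_pow, card_smul_finset]
  rw [le_rootMultiplicity_iff hF0]
  have hdvd : (X - C (t : ℝ)) ^ c ∣ C (Fintype.card (Equiv.Perm (Fin n)) : ℝ) * F := by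
    rw [heq]
    refine Dvd.dvd.mul_right (pow_dvd_pow_of_dvd ?_ c) R
    rw [← neg_sub, neg_dvd]
  exact ((isUnit_C.mpr hN0.isUnit).dvd_mul_left).mp hdvd

lemma properlyDividesOn_of_le_rootMultiplicity {t m : ℕ} {f : (Fin n → ℝ) → ℝ} {F : ℝ[X]}
    (hF0 : F ≠ 0) (hF : F.natDegree ≤ n) (hf : ∀ A, f (vertex A) = F.eval (#A : ℝ))
    (hm : m ≤ F.rootMultiplicity (t : ℝ)) :
    ProperlyDividesOn n (cube n) (fun x => ((t : ℝ) - ∑ i, x i) ^ m) f := by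
  have hdvd : (C (t : ℝ) - X) ^ m ∣ F := by
    refine (pow_dvd_pow_of_dvd ?_ m).trans ((le_rootMultiplicity_iff hF0).mp hm)
    rw [← neg_sub, neg_dvd]
  obtain ⟨G, rfl⟩ := hdvd
  have hdeg := natDegree_mul (left_ne_zero_of_mul hF0) (right_ne_zero_of_mul hF0)
  rw [natDegree_const_sub_X_pow] at hdeg
  refine ⟨fun x => G.eval (∑ i, x i), fun x hx => ?_, ?_⟩
  · obtain ⟨A, rfl⟩ := exists_eq_vertex hx
    beta_reduce
    rw [hf, eval_vertex_pow, sum_vertex, eval_mul]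
  · rw [degOn_eq_natDegree hF hf, hdeg, degOn_eq_natDegree (F := (C (t : ℝ) - X) ^ m)
      (by rw [natDegree_const_sub_X_pow]; omega) (eval_vertex_pow t m), natDegree_const_sub_X_pow,
      degOn_eq_natDegree (F := G) (by omega) fun A => by rw [sum_vertex]]

end Hypercube

open Hypercube Polynomial
open scoped Pointwise


theorem stmt7 (n t : ℕ) (ht : 2 * t ≤ n)
    (f : (Fin n → ℝ) → ℝ) (hsym : SymmOn n (cube n) f)
    (hdf : degOn n (cube n) f ≤ t)
    (c : ℕ) (hodd : Odd c)
    (hdiv : ProperlyDividesOn n (cube n) (fun x => ((t : ℝ) - ∑ i, x i) ^ c) f)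
    (hndiv : ¬ ProperlyDividesOn n (cube n) (fun x => ((t : ℝ) - ∑ i, x i) ^ (c + 1)) f)
    (d : ℕ) (hd : d ≤ t) :
    ¬ IsSosOn n (cube n) d f := by
  rintro ⟨m, g, hg, hfg⟩
  have htn : t ≤ n := by omega
  obtain ⟨F, hF, hf⟩ := exists_poly_of_symm (degOn_le_iff.mp hdf) fun σ A => by
    rw [vertex_smul]
    exact hsym σ⁻¹ _ (vertex_mem_cube A)
  by_cases hF0 : F = 0
  · have hf0 : ∀ A, f (vertex A) = 0 := by simpa [hF0] using hf
    obtain rfl := eq_zero_of_properlyDividesOn_zero hodd hf0 hdiv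
    refine hndiv ⟨fun _ => 0, fun x hx => ?_, ?_⟩
    · obtain ⟨A, rfl⟩ := exists_eq_vertex hx
      simp [hf0]
    · rw [degOn_eq_natDegree (F := 0) (by simp) (by simpa using hf0),
        degOn_eq_natDegree (F := C ((t : ℝ) ^ (c + 1))) (by simp) (by simp),
        degOn_eq_natDegree (F := 0) (by simp) (by simp)]
      simp
  have heven : Even (F.rootMultiplicity (t : ℝ)) :=
    even_rootMultiplicity ht (d + 1) F (Fin m) (fun i A => MvPolynomial.eval (vertex A) (g i))
      (by omega) hF0 (hF.trans htn) (fun i => eval_mem_lowDegree (hg i))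
      fun A => by rw [← hf, hfg _ (vertex_mem_cube A)]
  suffices hmult : Odd (F.rootMultiplicity (t : ℝ)) from Nat.not_even_iff_odd.mpr hmult heven
  by_cases hct : c ≤ t
  · have h1 := le_rootMultiplicity htn hct hF0 hF hf hdiv
    have h2 : ¬ c + 1 ≤ F.rootMultiplicity (t : ℝ) := fun h =>
      hndiv (properlyDividesOn_of_le_rootMultiplicity hF0 (hF.trans htn) hf h)
    rwa [show F.rootMultiplicity (t : ℝ) = c by omega]
  · obtain ⟨h, hfh, hdeg⟩ := hdiv
    have hpow : degOn n (cube n) (fun x => ((t : ℝ) - ∑ i, x i) ^ c) ≤ t := by omega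
    obtain ⟨R, hR, hRA⟩ := exists_poly_of_symm (degOn_le_iff.mp hpow)
      fun σ A => by simp only [sum_vertex, Finset.card_smul_finset]
    have ht1 : t ≤ 1 := by
      refine le_one_of_eval_eq_pow (not_le.mp hct) (R := -R) (by rwa [natDegree_neg]) ?_
      intro j hj
      obtain ⟨A, -, rfl⟩ := Finset.exists_subset_card_eq
        (show j ≤ (Finset.univ : Finset (Fin n)).card by simpa using hj.trans ht)
      rw [eval_neg, ← hRA, sum_vertex, ← hodd.neg_pow, neg_sub]
    have hroot : F.IsRoot (t : ℝ) := by
      obtain ⟨A, -, hA⟩ := Finset.exists_subset_card_eq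
        (show t ≤ (Finset.univ : Finset (Fin n)).card by simpa using htn)
      rw [IsRoot, ← hA, ← hf, hfh _ (vertex_mem_cube A)]
      simp [sum_vertex, hA, hodd.pos.ne']
    have h1 := (rootMultiplicity_pos hF0).mpr hroot
    have h2 : F.rootMultiplicity (t : ℝ) ≤ F.natDegree := by
      rw [← count_roots]
      exact (Multiset.count_le_card _ _).trans (card_roots' F)
    rw [show F.rootMultiplicity (t : ℝ) = 1 by omega]
    exact odd_one
end

section
/- Let X ⊆ ℝ^n be a finite set and fix natural numbers d, d_1, d_2. The set of functions f : X → ℝ such that f is the restriction to X of some polynomial of total degree at most 2d and f is (d_1,d_2)-rsos on X is a closed subset of the finite-dimensional real vector space of all functions X → ℝ (with its standard topology). -/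
/-- `f : X → ℝ` is `k`-sos on `X`: a finite sum of squares of polynomials of
total degree ≤ `k`, restricted to `X`. -/
def IsSosFun (n : ℕ) (X : Set (Fin n → ℝ)) (k : ℕ) (f : X → ℝ) : Prop :=
  ∃ (m : ℕ) (g : Fin m → MvPolynomial (Fin n) ℝ),
    (∀ i, (g i).totalDegree ≤ k) ∧
    ∀ x : X, f x = ∑ i, (MvPolynomial.eval (x : Fin n → ℝ) (g i)) ^ 2

/-- In a finite-dimensional space the convex hull of a compact set is compact. -/
theorem isCompact_convexHull_of_finiteDimensional {E : Type*} [NormedAddCommGroup E]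
    [NormedSpace ℝ E] [FiniteDimensional ℝ E] {s : Set E} (hs : IsCompact s) :
    IsCompact (convexHull ℝ s) := by
  rcases s.eq_empty_or_nonempty with rfl | ⟨x₀, hx₀⟩
  · simp
  let N := Module.finrank ℝ E + 1
  have himage : convexHull ℝ s = (fun p : (Fin N → ℝ) × (Fin N → E) => ∑ i, p.1 i • p.2 i) ''
      (stdSimplex ℝ (Fin N) ×ˢ Set.univ.pi fun _ => s) := by
    apply Set.Subset.antisymm
    · intro x hx
      obtain ⟨ι, _, z, w, hz, hind, hw, hw1, rfl⟩ := eq_pos_convex_span_of_mem_convexHull hx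
      have hcard : Fintype.card ι ≤ Fintype.card (Fin N) := by
        rw [Fintype.card_fin]
        exact hind.card_le_finrank_succ.trans (Nat.succ_le_succ (Submodule.finrank_le _))
      obtain ⟨e⟩ := Function.Embedding.nonempty_of_card_le hcard
      refine ⟨(Function.extend e w 0, Function.extend e z fun _ => x₀), ⟨⟨fun i => ?_, ?_⟩, ?_⟩, ?_⟩
      · by_cases hi : ∃ a, e a = i
        · obtain ⟨a, rfl⟩ := hi
          simpa [e.injective.extend_apply] using (hw a).le
        · simp [Function.extend_apply' _ _ _ hi]
      · rw [← hw1]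
        refine (Fintype.sum_of_injective e e.injective _ _ (fun i hi => ?_) fun i => ?_).symm
        · exact Function.extend_apply' _ _ _ hi
        · simp [e.injective.extend_apply]
      · intro i _
        by_cases hi : ∃ a, e a = i
        · obtain ⟨a, rfl⟩ := hi
          simpa [e.injective.extend_apply] using hz ⟨a, rfl⟩
        · simpa [Function.extend_apply' _ _ _ hi] using hx₀
      · refine (Fintype.sum_of_injective e e.injective _ _ (fun i hi => ?_) fun i => ?_).symm
        · have hi' : ¬ ∃ a, e a = i := hi
          simp [Function.extend_apply' _ _ _ hi']
        · simp [e.injective.extend_apply]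
    · rintro _ ⟨⟨w, z⟩, ⟨hw, hz⟩, rfl⟩
      exact (convex_convexHull ℝ s).sum_mem (fun i _ => hw.1 i) hw.2
        fun i _ => subset_convexHull ℝ s (hz i trivial)
  rw [himage]
  exact ((isCompact_stdSimplex ℝ (Fin N)).prod (isCompact_univ_pi fun _ => hs)).image (by fun_prop)

/-- Restrictions to `X` of polynomials of total degree at most `k`. -/
noncomputable def polyFun (n : ℕ) (X : Set (Fin n → ℝ)) (k : ℕ) : Submodule ℝ (X → ℝ) :=
  (MvPolynomial.restrictTotalDegree (Fin n) ℝ k).map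
    (LinearMap.pi fun x : X => (MvPolynomial.aeval (R := ℝ) (x : Fin n → ℝ)).toLinearMap)

section

variable {n : ℕ} {X : Set (Fin n → ℝ)} {k : ℕ}

theorem mem_polyFun {f : X → ℝ} : f ∈ polyFun n X k ↔
    ∃ p : MvPolynomial (Fin n) ℝ, p.totalDegree ≤ k ∧
      ∀ x : X, f x = MvPolynomial.eval (x : Fin n → ℝ) p := by
  simp only [polyFun, Submodule.mem_map, MvPolynomial.mem_restrictTotalDegree]
  refine exists_congr fun p => and_congr_right fun _ => ?_
  rw [eq_comm, funext_iff]
  simp [MvPolynomial.aeval_eq_eval]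

theorem isSosFun_iff {f : X → ℝ} : IsSosFun n X k f ↔
    ∃ (m : ℕ) (g : Fin m → X → ℝ), (∀ i, g i ∈ polyFun n X k) ∧ f = ∑ i, g i ^ 2 := by
  constructor
  · rintro ⟨m, p, hp, hf⟩
    refine ⟨m, fun i x => MvPolynomial.eval (x : Fin n → ℝ) (p i),
      fun i => mem_polyFun.2 ⟨p i, hp i, fun _ => rfl⟩, ?_⟩
    ext x
    simp [hf x]
  · rintro ⟨m, g, hg, rfl⟩
    choose p hp hgp using fun i => mem_polyFun.1 (hg i)
    exact ⟨m, p, hp, fun x => by simp [hgp]⟩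

theorem IsSosFun.add {f g : X → ℝ} (hf : IsSosFun n X k f) (hg : IsSosFun n X k g) :
    IsSosFun n X k (f + g) := by
  rw [isSosFun_iff] at *
  obtain ⟨m, u, hu, rfl⟩ := hf
  obtain ⟨l, v, hv, rfl⟩ := hg
  refine ⟨m + l, Fin.append u v, fun i => ?_, ?_⟩
  · induction i using Fin.addCases <;> simp [hu, hv]
  · simp [Fin.sum_univ_add]

theorem IsSosFun.smul {f : X → ℝ} (hf : IsSosFun n X k f) {c : ℝ} (hc : 0 ≤ c) :
    IsSosFun n X k (c • f) := by
  rw [isSosFun_iff] at *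
  obtain ⟨m, u, hu, rfl⟩ := hf
  exact ⟨m, fun i => √c • u i, fun i => Submodule.smul_mem _ _ (hu i),
    by simp [smul_pow, Real.sq_sqrt hc, Finset.smul_sum]⟩

theorem IsSosFun.nonneg {f : X → ℝ} (hf : IsSosFun n X k f) : 0 ≤ f := by
  obtain ⟨m, p, -, hp⟩ := hf
  intro x
  rw [hp x]
  exact Finset.sum_nonneg fun i _ => sq_nonneg _

theorem isSosFun_one : IsSosFun n X k 1 :=
  ⟨1, fun _ => 1, by simp, by simp⟩

theorem isSosFun_sq {g : X → ℝ} (hg : g ∈ polyFun n X k) : IsSosFun n X k (g ^ 2) :=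
  isSosFun_iff.2 ⟨1, fun _ => g, fun _ => hg, by simp⟩

theorem isCompact_sq_polyFun [Fintype X] :
    IsCompact ((fun g : X → ℝ => g ^ 2) '' {g | g ∈ polyFun n X k ∧ ∑ x, g x ^ 2 = 1}) := by
  refine IsCompact.image (Metric.isCompact_of_isClosed_isBounded ?_ ?_) (by fun_prop)
  · exact (Submodule.closed_of_finiteDimensional (polyFun n X k)).inter
      (isClosed_eq (by fun_prop) continuous_const)
  · refine (Metric.isBounded_closedBall (x := (0 : X → ℝ)) (r := 1)).subset ?_
    rintro g ⟨-, hg⟩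
    rw [mem_closedBall_zero_iff, pi_norm_le_iff_of_nonneg zero_le_one]
    intro x
    rw [Real.norm_eq_abs, ← sq_le_one_iff_abs_le_one, ← hg]
    exact Finset.single_le_sum (f := fun x => g x ^ 2) (fun y _ => sq_nonneg _)
      (Finset.mem_univ x)

/-- The sum of squares functions of total mass one form the convex hull of the normalized squares. -/
theorem setOf_isSosFun_sum_eq_one [Fintype X] :
    {h : X → ℝ | IsSosFun n X k h ∧ ∑ x, h x = 1} =
      convexHull ℝ ((fun g : X → ℝ => g ^ 2) '' {g | g ∈ polyFun n X k ∧ ∑ x, g x ^ 2 = 1}) := by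
  apply Set.Subset.antisymm
  · rintro h ⟨hh, hsum⟩
    obtain ⟨m, g, hg, rfl⟩ := isSosFun_iff.1 hh
    set w : Fin m → ℝ := fun i => ∑ x, g i x ^ 2 with hw
    have hw0 : ∀ i, 0 ≤ w i := fun i => Finset.sum_nonneg fun x _ => sq_nonneg _
    have hw1 : ∑ i, w i = 1 := by
      rw [← hsum, hw, Finset.sum_comm]
      simp
    have hmem := (convex_convexHull ℝ ((fun g : X → ℝ => g ^ 2) ''
      {g | g ∈ polyFun n X k ∧ ∑ x, g x ^ 2 = 1})).finsum_mem (w := w)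
      (z := fun i => ((√(w i))⁻¹ • g i) ^ 2) hw0 (by rwa [finsum_eq_sum_of_fintype])
      fun i hi => subset_convexHull ℝ _ ⟨_, ⟨Submodule.smul_mem _ _ (hg i), by
        simp only [Pi.smul_apply, smul_eq_mul, mul_pow, inv_pow, Real.sq_sqrt (hw0 i),
          ← Finset.mul_sum]
        exact inv_mul_cancel₀ hi⟩, rfl⟩
    rw [finsum_eq_sum_of_fintype] at hmem
    convert hmem using 2 with i
    rcases eq_or_ne (w i) 0 with hi | hi
    · rw [hi, zero_smul]
      ext x
      exact (Finset.sum_eq_zero_iff_of_nonneg fun x _ => sq_nonneg (g i x)).1 hi x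
        (Finset.mem_univ x)
    · rw [smul_pow, inv_pow, Real.sq_sqrt (hw0 i), smul_inv_smul₀ hi]
  · refine convexHull_min ?_ ?_
    · rintro _ ⟨g, ⟨hg, hsum⟩, rfl⟩
      exact ⟨isSosFun_sq hg, by simpa using hsum⟩
    · rintro u ⟨hu, hu1⟩ v ⟨hv, hv1⟩ a b ha hb hab
      refine ⟨(hu.smul ha).add (hv.smul hb), ?_⟩
      simp [Finset.sum_add_distrib, ← Finset.mul_sum, hu1, hv1, hab]

theorem isCompact_setOf_isSosFun_sum_eq_one [Fintype X] :
    IsCompact {h : X → ℝ | IsSosFun n X k h ∧ ∑ x, h x = 1} := by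
  rw [setOf_isSosFun_sum_eq_one]
  exact isCompact_convexHull_of_finiteDimensional isCompact_sq_polyFun

theorem IsSosFun.sum_pos [Fintype X] {h : X → ℝ} (hh : IsSosFun n X k h) (h0 : h ≠ 0) :
    0 < ∑ x, h x :=
  Fintype.sum_pos (lt_of_le_of_ne hh.nonneg h0.symm)

theorem IsSosFun.inv_sum_smul_mem [Fintype X] {h : X → ℝ} (hh : IsSosFun n X k h) (h0 : h ≠ 0) :
    (∑ x, h x)⁻¹ • h ∈ {h : X → ℝ | IsSosFun n X k h ∧ ∑ x, h x = 1} := by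
  have hpos := hh.sum_pos h0
  refine ⟨hh.smul (inv_nonneg.2 hpos.le), ?_⟩
  simp only [Pi.smul_apply, smul_eq_mul, ← Finset.mul_sum]
  exact inv_mul_cancel₀ hpos.ne'

theorem isSosFun_iff_exists_sum_smul [Fintype X] [Nonempty X] {F : X → ℝ} :
    IsSosFun n X k F ↔ ∃ b ∈ {h : X → ℝ | IsSosFun n X k h ∧ ∑ x, h x = 1},
      F = (∑ x, F x) • b ∧ 0 ≤ ∑ x, F x := by
  constructor
  · intro hF
    rcases eq_or_ne F 0 with rfl | h0
    · exact ⟨_, isSosFun_one.inv_sum_smul_mem one_ne_zero, by simp⟩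
    · exact ⟨_, hF.inv_sum_smul_mem h0, (smul_inv_smul₀ (hF.sum_pos h0).ne' F).symm,
        (hF.sum_pos h0).le⟩
  · rintro ⟨b, ⟨hb, -⟩, hF, hs⟩
    rw [hF]
    exact hb.smul hs

theorem exists_isSosFun_mul_iff [Fintype X] [Nonempty X] {d₁ d₂ : ℕ} {f : X → ℝ} :
    (∃ h : X → ℝ, IsSosFun n X d₁ h ∧ h ≠ 0 ∧ IsSosFun n X d₂ (f * h)) ↔
      ∃ p ∈ {h : X → ℝ | IsSosFun n X d₁ h ∧ ∑ x, h x = 1} ×ˢ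
          {h : X → ℝ | IsSosFun n X d₂ h ∧ ∑ x, h x = 1},
        f * p.1 = (∑ x, f x * p.1 x) • p.2 ∧ 0 ≤ ∑ x, f x * p.1 x := by
  constructor
  · rintro ⟨h, hh, h0, hfh⟩
    have hfh' : IsSosFun n X d₂ (f * ((∑ x, h x)⁻¹ • h)) := by
      rw [mul_smul_comm]
      exact hfh.smul (inv_nonneg.2 (hh.sum_pos h0).le)
    obtain ⟨b, hb, hfb⟩ := isSosFun_iff_exists_sum_smul.1 hfh'
    exact ⟨(_, b), ⟨hh.inv_sum_smul_mem h0, hb⟩, hfb⟩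
  · rintro ⟨⟨h, b⟩, ⟨⟨hh, hh1⟩, hb⟩, hfb⟩
    refine ⟨h, hh, ?_, isSosFun_iff_exists_sum_smul.2 ⟨b, hb, hfb⟩⟩
    rintro rfl
    simp at hh1

end

theorem isClosed_setOf_exists_mem_of_isCompact {P E : Type*} [TopologicalSpace P]
    [TopologicalSpace E] {K : Set P} (hK : IsCompact K) {C : Set (P × E)} (hC : IsClosed C) :
    IsClosed {f : E | ∃ p ∈ K, (p, f) ∈ C} := by
  have : CompactSpace K := isCompact_iff_compactSpace.1 hK
  convert isClosedMap_snd_of_compactSpace (X := K) (Y := E) _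
    (hC.preimage (f := fun q : K × E => ((q.1 : P), q.2)) (by fun_prop)) using 1
  ext f
  simp

theorem stmt8 (n : ℕ) (X : Set (Fin n → ℝ)) (hX : X.Finite) (d d₁ d₂ : ℕ) :
    IsClosed {f : X → ℝ |
      (∃ p : MvPolynomial (Fin n) ℝ, p.totalDegree ≤ 2 * d ∧
        ∀ x : X, f x = MvPolynomial.eval (x : Fin n → ℝ) p) ∧
      ∃ h : X → ℝ, IsSosFun n X d₁ h ∧ h ≠ 0 ∧ IsSosFun n X d₂ (f * h)} := by
  have := hX.fintype
  cases isEmpty_or_nonempty X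
  · convert isClosed_empty using 1
    refine Set.eq_empty_of_forall_notMem ?_
    rintro f ⟨-, h, -, h0, -⟩
    exact h0 (Subsingleton.elim _ _)
  simp only [← mem_polyFun, exists_isSosFun_mul_iff]
  refine (Submodule.closed_of_finiteDimensional (polyFun n X (2 * d))).inter
    (isClosed_setOf_exists_mem_of_isCompact
      (isCompact_setOf_isSosFun_sum_eq_one.prod isCompact_setOf_isSosFun_sum_eq_one)
      (C := {q : ((X → ℝ) × (X → ℝ)) × (X → ℝ) | q.2 * q.1.1 = (∑ x, q.2 x * q.1.1 x) • q.1.2 ∧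
        0 ≤ ∑ x, q.2 x * q.1.1 x}) ?_)
  rw [Set.ofPred_and]
  apply IsClosed.inter
  · apply isClosed_eq <;> fun_prop
  · apply isClosed_le <;> fun_prop
end

section
/- Let X = {v_1,…,v_m} ⊆ ℝ^n be a finite set, let μ_1,…,μ_m be nonzero real numbers, and define the linear functional ℓ(f) = Σ_{i=1}^m μ_i f(v_i) on functions f : X → ℝ. If ℓ(g²) ≥ 0 for every polynomial g of total degree at most d, then the number of indices i with μ_i > 0 is at least H_X(d). -/
/-- The Hilbert function of `X`: the dimension of the space of functions `X → ℝ`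
that are restrictions of polynomials of total degree at most `t`. -/
noncomputable def hilbert (n : ℕ) (X : Set (Fin n → ℝ)) (t : ℕ) : ℕ :=
  Module.finrank ℝ (Submodule.span ℝ
    {f : X → ℝ | ∃ p : MvPolynomial (Fin n) ℝ, p.totalDegree ≤ t ∧
      ∀ x : X, f x = MvPolynomial.eval (x : Fin n → ℝ) p})

/-- Restrictions of polynomials of degree at most `t` already form a linear space. -/
theorem exists_polynomial_of_mem_span {n t : ℕ} {X : Set (Fin n → ℝ)} {f : X → ℝ}
    (hf : f ∈ Submodule.span ℝ {f : X → ℝ | ∃ p : MvPolynomial (Fin n) ℝ, p.totalDegree ≤ t ∧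
      ∀ x : X, f x = MvPolynomial.eval (x : Fin n → ℝ) p}) :
    ∃ p : MvPolynomial (Fin n) ℝ, p.totalDegree ≤ t ∧
      ∀ x : X, f x = MvPolynomial.eval (x : Fin n → ℝ) p := by
  induction hf using Submodule.span_induction with
  | mem f hf => exact hf
  | zero => exact ⟨0, by simp, by simp⟩
  | add f g _ _ hf hg =>
    obtain ⟨p, hp, hfp⟩ := hf
    obtain ⟨q, hq, hgq⟩ := hg
    exact ⟨p + q, (MvPolynomial.totalDegree_add p q).trans (max_le hp hq),
      fun x => by simp [hfp, hgq]⟩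
  | smul c f _ hf =>
    obtain ⟨p, hp, hfp⟩ := hf
    exact ⟨c • p, (MvPolynomial.totalDegree_smul_le c p).trans hp,
      fun x => by simp [hfp, MvPolynomial.smul_eval]⟩

/-- A nonnegative diagonal quadratic form value forces a vector to vanish as soon as it
vanishes at all indices of positive weight. -/
theorem eq_zero_of_sum_mul_sq_nonneg {ι : Type*} [Fintype ι] {μ a : ι → ℝ}
    (hμ : ∀ i, μ i ≠ 0) (hsum : 0 ≤ ∑ i, μ i * a i ^ 2) (ha : ∀ i, 0 < μ i → a i = 0) (i : ι) :
    a i = 0 := by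
  have hle : ∀ j ∈ Finset.univ, μ j * a j ^ 2 ≤ 0 := fun j _ => by
    rcases lt_or_ge 0 (μ j) with h | h
    · simp [ha j h]
    · exact mul_nonpos_of_nonpos_of_nonneg h (sq_nonneg _)
  have hzero := (Finset.sum_eq_zero_iff_of_nonpos hle).1
    (le_antisymm (Finset.sum_nonpos hle) hsum) i (Finset.mem_univ i)
  simpa [hμ i] using hzero

theorem stmt9 (n m : ℕ) (v : Fin m → (Fin n → ℝ)) (hv : Function.Injective v)
    (μ : Fin m → ℝ) (hμ : ∀ i, μ i ≠ 0) (d : ℕ)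
    (hnonneg : ∀ g : MvPolynomial (Fin n) ℝ, g.totalDegree ≤ d →
      0 ≤ ∑ i, μ i * (MvPolynomial.eval (v i) g) ^ 2) :
    hilbert n (Set.range v) d ≤ (Finset.univ.filter fun i => 0 < μ i).card := by
  let restrict : (Set.range v → ℝ) →ₗ[ℝ] ({i // 0 < μ i} → ℝ) :=
    LinearMap.funLeft ℝ ℝ fun i => ⟨v i, i, rfl⟩
  rw [← Fintype.card_subtype, ← Module.finrank_fintype_fun_eq_card ℝ, hilbert]
  refine LinearMap.finrank_le_finrank_of_injective (f := restrict.domRestrict _) ?_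
  rw [injective_iff_map_eq_zero]
  rintro ⟨f, hf⟩ hzero
  obtain ⟨p, hp, hfp⟩ := exists_polynomial_of_mem_span hf
  ext ⟨_, i, rfl⟩
  refine (hfp _).trans (eq_zero_of_sum_mul_sq_nonneg hμ (hnonneg p hp) (fun j hj => ?_) i)
  exact (hfp ⟨v j, j, rfl⟩).symm.trans (congrFun hzero ⟨j, hj⟩)
end

section
/- Let C = {0,1}^n, fix a natural number t with 0 ≤ t ≤ n, and let T = {x ∈ C : x_1+…+x_n = t}. Let d be a natural number with d ≤ t ≤ n−d, and let f : C → ℝ be a function, not identically zero on C, with deg_C(f) ≤ d, such that f(x) = 0 for every x ∈ T. Then the function ℓ(x) = t − (x_1+…+x_n) properly divides f: there exists a function g : C → ℝ with f(x) = ℓ(x)·g(x) for all x ∈ C and deg_C(f) = 1 + deg_C(g). -/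
/-- If every `t`-subset of `V` has vanishing sum of `c` over its `e`-subsets, and
`e ≤ t ≤ #V - e`, then `c` vanishes on the `e`-subsets of `V`. -/
theorem eq_zero_of_sum_powersetCard_eq_zero {α : Type*} [DecidableEq α] (e : ℕ) :
    ∀ (t : ℕ) (V : Finset α) (c : Finset α → ℝ), e ≤ t → t + e ≤ V.card →
      (∀ T ⊆ V, T.card = t → ∑ S ∈ T.powersetCard e, c S = 0) →
      ∀ S ⊆ V, S.card = e → c S = 0 := by
  induction e with
  | zero =>
    intro t V c _ htV h S _ hS
    obtain ⟨T, hTV, hT⟩ := Finset.exists_subset_card_eq (show t ≤ V.card by omega)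
    rw [Finset.card_eq_zero.mp hS]
    simpa using h T hTV hT
  | succ e ih =>
    intro t V c het htV h
    obtain ⟨t, rfl⟩ : ∃ s, t = s + 1 := ⟨t - 1, by omega⟩
    have exchange : ∀ i ∈ V, ∀ j ∈ V, i ≠ j → ∀ A ⊆ (V.erase i).erase j, A.card = e →
        c (insert i A) = c (insert j A) := by
      intro i hi j hj hij A hA hAe
      refine sub_eq_zero.mp (ih t ((V.erase i).erase j)
        (fun A ↦ c (insert i A) - c (insert j A)) (by omega) ?_ ?_ A hA hAe)
      · rw [Finset.card_erase_of_mem (by simp [hj, hij.symm]), Finset.card_erase_of_mem hi]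
        omega
      · intro T hT hTt
        have hiT : i ∉ T := fun hh ↦ by simpa using hT hh
        have hjT : j ∉ T := fun hh ↦ by simpa using hT hh
        have hTV : T ⊆ V := hT.trans ((Finset.erase_subset _ _).trans (Finset.erase_subset _ _))
        have expand : ∀ k ∈ V, k ∉ T → ∑ S ∈ T.powersetCard (e + 1), c S +
            ∑ S ∈ T.powersetCard e, c (insert k S) = 0 := by
          intro k hk hkT
          rw [← h (insert k T) (Finset.insert_subset hk hTV)
            (by rw [Finset.card_insert_of_notMem hkT, hTt]),
            Finset.powersetCard_succ_insert hkT, Finset.sum_union, Finset.sum_image]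
          · intro A hA B hB hAB
            have hA' : k ∉ A := fun hh ↦ hkT ((Finset.mem_powersetCard.mp hA).1 hh)
            have hB' : k ∉ B := fun hh ↦ hkT ((Finset.mem_powersetCard.mp hB).1 hh)
            rw [← Finset.erase_insert hA', ← Finset.erase_insert hB', hAB]
          · rw [Finset.disjoint_left]
            intro A hA hA'
            obtain ⟨B, -, rfl⟩ := Finset.mem_image.mp hA'
            exact hkT ((Finset.mem_powersetCard.mp hA).1 (Finset.mem_insert_self _ _))
        rw [Finset.sum_sub_distrib]
        linarith [expand i hi hiT, expand j hj hjT]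
    have const : ∀ (m : ℕ) (S S' : Finset α), S ⊆ V → S' ⊆ V → S.card = e + 1 →
        S'.card = e + 1 → (S \ S').card = m → c S = c S' := by
      intro m
      induction m with
      | zero =>
        intro S S' _ _ hS hS' hm
        rw [Finset.eq_of_subset_of_card_le
          (Finset.sdiff_eq_empty_iff_subset.mp (Finset.card_eq_zero.mp hm)) (by omega)]
      | succ m ihm =>
        intro S S' hSV hSV' hS hS' hm
        obtain ⟨i, hi⟩ := Finset.card_pos.mp (show 0 < (S \ S').card by omega)
        have hcard : (S' \ S).card = m + 1 := by
          rw [← hm]; exact Finset.card_sdiff_comm (by omega)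
        obtain ⟨j, hj⟩ := Finset.card_pos.mp (show 0 < (S' \ S).card by omega)
        rw [Finset.mem_sdiff] at hi hj
        have hij : i ≠ j := fun hh ↦ hi.2 (hh ▸ hj.1)
        have hstep := exchange i (hSV hi.1) j (hSV' hj.1) hij (S.erase i)
          (fun k hk ↦ by
            rw [Finset.mem_erase] at hk
            simp only [Finset.mem_erase]
            exact ⟨fun hh ↦ hj.2 (hh ▸ hk.2), hk.1, hSV hk.2⟩)
          (by rw [Finset.card_erase_of_mem hi.1, hS]; rfl)
        rw [Finset.insert_erase hi.1] at hstep
        rw [hstep]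
        have hji : j ∉ S.erase i := fun hh ↦ hj.2 (Finset.mem_of_mem_erase hh)
        refine ihm _ _ (Finset.insert_subset (hSV' hj.1) ((Finset.erase_subset _ _).trans hSV))
          hSV' ?_ hS' ?_
        · rw [Finset.card_insert_of_notMem hji, Finset.card_erase_of_mem hi.1, hS]; rfl
        · rw [Finset.insert_sdiff_of_mem _ hj.1, Finset.erase_sdiff_comm,
            Finset.card_erase_of_mem (by simp [hi]), hm]; rfl
    intro S hSV hS
    obtain ⟨T, hTV, hT⟩ := Finset.exists_subset_card_eq (show t + 1 ≤ V.card by omega)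
    have hsum := h T hTV hT
    rw [Finset.sum_congr rfl fun A hA ↦ const _ A S ((Finset.mem_powersetCard.mp hA).1.trans hTV)
      hSV (Finset.mem_powersetCard.mp hA).2 hS rfl, Finset.sum_const, Finset.card_powersetCard,
      hT, nsmul_eq_mul, mul_eq_zero] at hsum
    refine hsum.resolve_left ?_
    exact_mod_cast (Nat.choose_pos het).ne'

/-- On the cube, `F` is `t - ∑ xᵢ` times a polynomial of degree at most `k`, plus a homogeneous
multilinear polynomial of degree `k + 1`. -/
def HasSliceDecomposition (n t k : ℕ) (F : (Fin n → ℝ) → ℝ) : Prop :=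
  ∃ (q : MvPolynomial (Fin n) ℝ) (c : Finset (Fin n) → ℝ), q.totalDegree ≤ k ∧
    ∀ x ∈ cube n, F x = ((t : ℝ) - ∑ i, x i) * MvPolynomial.eval x q +
      ∑ S ∈ Finset.univ.powersetCard (k + 1), c S * ∏ i ∈ S, x i

namespace HasSliceDecomposition

variable {n t k : ℕ} {F G : (Fin n → ℝ) → ℝ}

theorem congr (hF : HasSliceDecomposition n t k F) (h : ∀ x ∈ cube n, G x = F x) :
    HasSliceDecomposition n t k G := by
  obtain ⟨q, c, hq, hc⟩ := hF
  exact ⟨q, c, hq, fun x hx ↦ (h x hx).trans (hc x hx)⟩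

theorem zero : HasSliceDecomposition n t k (fun _ ↦ 0) :=
  ⟨0, 0, by simp, by simp⟩

theorem add (hF : HasSliceDecomposition n t k F) (hG : HasSliceDecomposition n t k G) :
    HasSliceDecomposition n t k (fun x ↦ F x + G x) := by
  obtain ⟨q, c, hq, hc⟩ := hF
  obtain ⟨r, b, hr, hb⟩ := hG
  refine ⟨q + r, c + b, (MvPolynomial.totalDegree_add _ _).trans (max_le hq hr), ?_⟩
  intro x hx
  simp only [hc x hx, hb x hx, map_add, Pi.add_apply, add_mul, Finset.sum_add_distrib]
  ring

theorem const_mul (a : ℝ) (hF : HasSliceDecomposition n t k F) :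
    HasSliceDecomposition n t k (fun x ↦ a * F x) := by
  obtain ⟨q, c, hq, hc⟩ := hF
  refine ⟨a • q, fun S ↦ a * c S, (MvPolynomial.totalDegree_smul_le _ _).trans hq, ?_⟩
  intro x hx
  simp only [hc x hx, MvPolynomial.smul_eval, mul_assoc, ← Finset.mul_sum]
  ring

theorem sum {ι : Type*} (s : Finset ι) {F : ι → (Fin n → ℝ) → ℝ}
    (hF : ∀ i ∈ s, HasSliceDecomposition n t k (F i)) :
    HasSliceDecomposition n t k (fun x ↦ ∑ i ∈ s, F i x) := by
  classical
  induction s using Finset.induction_on with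
  | empty => simpa using zero
  | insert a s ha ih =>
    simp only [Finset.sum_insert ha]
    exact (hF a (Finset.mem_insert_self _ _)).add
      (ih fun i hi ↦ hF i (Finset.mem_insert_of_mem hi))

theorem prod_coord (hkt : k < t) (m : ℕ) : ∀ S : Finset (Fin n), S.card + m = k + 1 →
    HasSliceDecomposition n t k (fun x ↦ ∏ i ∈ S, x i) := by
  classical
  induction m with
  | zero =>
    intro S hS
    refine ⟨0, fun A ↦ if A = S then 1 else 0, by simp, fun x _ ↦ ?_⟩
    simp only [map_zero, mul_zero, zero_add, ite_mul, one_mul, zero_mul, Finset.sum_ite_eq']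
    rw [if_pos (Finset.mem_powersetCard.mpr ⟨Finset.subset_univ _, by omega⟩)]
  | succ m ih =>
    intro S hS
    have hlead : HasSliceDecomposition n t k
        (fun x ↦ ((t : ℝ) - ∑ i, x i) * ∏ i ∈ S, x i) := by
      refine ⟨∏ i ∈ S, MvPolynomial.X i, 0, ?_, fun x _ ↦ by simp⟩
      refine (MvPolynomial.totalDegree_finsetProd _ _).trans ?_
      simp only [MvPolynomial.totalDegree_X, Finset.sum_const, smul_eq_mul]
      omega
    have hrest : HasSliceDecomposition n t k
        (fun x ↦ ∑ j ∈ Sᶜ, ∏ i ∈ insert j S, x i) := by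
      refine sum _ fun j hj ↦ ih _ ?_
      rw [Finset.card_insert_of_notMem (Finset.mem_compl.mp hj)]
      omega
    refine ((hlead.add hrest).const_mul ((t : ℝ) - S.card)⁻¹).congr fun x hx ↦ ?_
    have hne : (t : ℝ) - S.card ≠ 0 := by
      have : (S.card : ℝ) < t := by exact_mod_cast (show S.card < t by omega)
      linarith
    rw [eq_inv_mul_iff_mul_eq₀ hne, ← Finset.sum_add_sum_compl S x]
    have hin : (∑ i ∈ S, x i) * ∏ i ∈ S, x i = S.card * ∏ i ∈ S, x i := by
      rw [Finset.sum_mul, ← nsmul_eq_mul, ← Finset.sum_const]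
      refine Finset.sum_congr rfl fun i hi ↦ ?_
      rcases hx i with h | h
      · rw [Finset.prod_eq_zero hi h, mul_zero]
      · rw [h, one_mul]
    have hout : ∑ j ∈ Sᶜ, ∏ i ∈ insert j S, x i = (∑ j ∈ Sᶜ, x j) * ∏ i ∈ S, x i := by
      rw [Finset.sum_mul]
      exact Finset.sum_congr rfl fun j hj ↦ Finset.prod_insert (Finset.mem_compl.mp hj)
    rw [hout]
    linear_combination hin

theorem eval (hkt : k < t) (p : MvPolynomial (Fin n) ℝ) (hp : p.totalDegree ≤ k + 1) :
    HasSliceDecomposition n t k (fun x ↦ MvPolynomial.eval x p) := by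
  have key : HasSliceDecomposition n t k
      (fun x ↦ ∑ m ∈ p.support, p.coeff m * ∏ i ∈ m.support, x i) := by
    refine sum _ fun m hm ↦ (prod_coord hkt (k + 1 - m.support.card) _ ?_).const_mul _
    have hcard : m.support.card ≤ m.sum fun _ e ↦ e := by
      rw [Finset.card_eq_sum_ones]
      exact Finset.sum_le_sum fun i hi ↦ Nat.one_le_iff_ne_zero.mpr (Finsupp.mem_support_iff.mp hi)
    have := MvPolynomial.le_totalDegree hm
    omega
  refine key.congr fun x hx ↦ ?_
  rw [MvPolynomial.eval_eq]
  refine Finset.sum_congr rfl fun m _ ↦ ?_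
  congr 1
  refine Finset.prod_congr rfl fun i hi ↦ ?_
  rcases hx i with h | h
  · rw [h, zero_pow (Finsupp.mem_support_iff.mp hi)]
  · rw [h, one_pow]

end HasSliceDecomposition

/-- The 0/1 indicator vector of a finite set of coordinates. -/
def indicatorVec {n : ℕ} (T : Finset (Fin n)) : Fin n → ℝ := fun i ↦ if i ∈ T then 1 else 0

theorem indicatorVec_mem_cube {n : ℕ} (T : Finset (Fin n)) : indicatorVec T ∈ cube n := by
  intro i
  by_cases h : i ∈ T <;> simp [indicatorVec, h]

theorem sum_indicatorVec {n : ℕ} (T : Finset (Fin n)) : ∑ i, indicatorVec T i = T.card := by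
  simp [indicatorVec]

theorem sum_mul_prod_indicatorVec {n : ℕ} (e : ℕ) (c : Finset (Fin n) → ℝ) (T : Finset (Fin n)) :
    ∑ S ∈ Finset.univ.powersetCard e, c S * ∏ i ∈ S, indicatorVec T i =
      ∑ S ∈ T.powersetCard e, c S := by
  symm
  refine Finset.sum_subset_zero_on_sdiff (Finset.powersetCard_mono (Finset.subset_univ T))
    (fun S hS ↦ ?_) (fun S hS ↦ ?_)
  · simp only [Finset.mem_sdiff, Finset.mem_powersetCard, Finset.subset_univ, true_and,
      not_and'] at hS
    obtain ⟨i, hi, hiT⟩ := Finset.not_subset.mp (hS.2 hS.1)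
    rw [Finset.prod_eq_zero hi (by simp [indicatorVec, hiT]), mul_zero]
  · rw [Finset.prod_eq_one, mul_one]
    intro i hi
    simp [indicatorVec, (Finset.mem_powersetCard.mp hS).1 hi]

theorem exists_eval_eq_on_cube (n : ℕ) (f : (Fin n → ℝ) → ℝ) :
    ∃ p : MvPolynomial (Fin n) ℝ, ∀ x ∈ cube n, MvPolynomial.eval x p = f x := by
  classical
  refine ⟨∑ y ∈ Fintype.piFinset fun _ : Fin n ↦ ({0, 1} : Finset ℝ), MvPolynomial.C (f y) *
    ∏ i, (MvPolynomial.C (1 - y i) + MvPolynomial.C (2 * y i - 1) * MvPolynomial.X i),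
    fun x hx ↦ ?_⟩
  simp only [map_sum, map_mul, map_prod, map_add, MvPolynomial.eval_C, MvPolynomial.eval_X]
  rw [Finset.sum_eq_single x]
  · rw [Finset.prod_eq_one, mul_one]
    intro i _
    rcases hx i with h | h <;> rw [h] <;> norm_num
  · intro y hy hyx
    obtain ⟨i, hi⟩ := Function.ne_iff.mp hyx
    rw [Finset.prod_eq_zero (Finset.mem_univ i), mul_zero]
    have hyi := Fintype.mem_piFinset.mp hy i
    simp only [Finset.mem_insert, Finset.mem_singleton] at hyi
    rcases hx i with h | h <;> rcases hyi with h' | h' <;> rw [h, h'] at hi ⊢ <;>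
      first | exact absurd rfl hi | norm_num
  · intro hx'
    refine absurd (Fintype.mem_piFinset.mpr fun i ↦ ?_) hx'
    simpa using hx i

theorem degOn_le {n d : ℕ} {X : Set (Fin n → ℝ)} {f : (Fin n → ℝ) → ℝ}
    (p : MvPolynomial (Fin n) ℝ) (hp : p.totalDegree ≤ d)
    (h : ∀ x ∈ X, MvPolynomial.eval x p = f x) : degOn n X f ≤ d :=
  Nat.sInf_le ⟨p, hp, h⟩

theorem exists_totalDegree_le_degOn_cube {n : ℕ} (f : (Fin n → ℝ) → ℝ) :
    ∃ p : MvPolynomial (Fin n) ℝ, p.totalDegree ≤ degOn n (cube n) f ∧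
      ∀ x ∈ cube n, MvPolynomial.eval x p = f x := by
  obtain ⟨p, hp⟩ := exists_eval_eq_on_cube n f
  exact Nat.sInf_mem (s := {d | ∃ p : MvPolynomial (Fin n) ℝ, p.totalDegree ≤ d ∧
    ∀ x ∈ cube n, MvPolynomial.eval x p = f x}) ⟨p.totalDegree, p, le_rfl, hp⟩

theorem totalDegree_C_sub_sum_X_le (n : ℕ) (a : ℝ) :
    (MvPolynomial.C a - ∑ i : Fin n, MvPolynomial.X i).totalDegree ≤ 1 := by
  refine (MvPolynomial.totalDegree_sub _ _).trans (max_le (by simp) ?_)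
  refine (MvPolynomial.totalDegree_finsetSum _ _).trans (Finset.sup_le fun i _ ↦ ?_)
  simp

theorem stmt10 (n t d : ℕ) (ht : t ≤ n) (hd : d ≤ t) (hdn : t + d ≤ n)
    (f : (Fin n → ℝ) → ℝ) (hf0 : ∃ x ∈ cube n, f x ≠ 0)
    (hdeg : degOn n (cube n) f ≤ d)
    (hvanish : ∀ x ∈ cube n, (∑ i, x i) = (t : ℝ) → f x = 0) :
    ∃ g : (Fin n → ℝ) → ℝ, (∀ x ∈ cube n, f x = ((t : ℝ) - ∑ i, x i) * g x) ∧
      degOn n (cube n) f = 1 + degOn n (cube n) g := by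
  obtain ⟨p, hp, hpf⟩ := exists_totalDegree_le_degOn_cube f
  obtain ⟨T, -, hT⟩ := Finset.exists_subset_card_eq
    (show t ≤ (Finset.univ : Finset (Fin n)).card by simpa using ht)
  have hfT : ∀ T : Finset (Fin n), T.card = t → f (indicatorVec T) = 0 := fun T hT ↦
    hvanish _ (indicatorVec_mem_cube T) (by rw [sum_indicatorVec, hT])
  rcases hk : degOn n (cube n) f with _ | k
  · rw [hk, Nat.le_zero, MvPolynomial.totalDegree_eq_zero_iff_eq_C] at hp
    obtain ⟨x, hx, hfx⟩ := hf0
    have hconst : ∀ y ∈ cube n, f y = p.coeff 0 := fun y hy ↦ by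
      rw [← hpf y hy, hp]; simp
    refine absurd ?_ hfx
    rw [hconst x hx, ← hconst _ (indicatorVec_mem_cube T), hfT T hT]
  · rw [hk] at hp hdeg
    obtain ⟨q, c, hq, hqc⟩ :=
      (HasSliceDecomposition.eval (t := t) (by omega) p hp).congr fun x hx ↦ (hpf x hx).symm
    have hc : ∀ S ⊆ Finset.univ, S.card = k + 1 → c S = 0 := by
      refine eq_zero_of_sum_powersetCard_eq_zero (k + 1) t Finset.univ c (by omega)
        (by simp only [Finset.card_univ, Fintype.card_fin]; omega) fun T _ hT ↦ ?_
      have h := hqc _ (indicatorVec_mem_cube T)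
      rw [hfT T hT, sum_indicatorVec, hT, sub_self, zero_mul,
        zero_add, sum_mul_prod_indicatorVec] at h
      exact h.symm
    have hfq : ∀ x ∈ cube n, f x = ((t : ℝ) - ∑ i, x i) * MvPolynomial.eval x q := by
      intro x hx
      rw [hqc x hx, add_eq_left]
      refine Finset.sum_eq_zero fun S hS ↦ ?_
      rw [hc S (Finset.subset_univ S) (Finset.mem_powersetCard.mp hS).2, zero_mul]
    refine ⟨fun x ↦ MvPolynomial.eval x q, hfq, le_antisymm ?_ ?_⟩
    · obtain ⟨r, hr, hrq⟩ := exists_totalDegree_le_degOn_cube fun x ↦ MvPolynomial.eval x q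
      rw [← hk]
      refine degOn_le ((MvPolynomial.C (t : ℝ) - ∑ i, MvPolynomial.X i) * r)
        ((MvPolynomial.totalDegree_mul _ _).trans
          (add_le_add (totalDegree_C_sub_sum_X_le n t) hr)) fun x hx ↦ ?_
      rw [hfq x hx, map_mul, hrq x hx]
      simp
    · have := degOn_le (X := cube n) q hq fun _ _ ↦ rfl
      omega
end

section
/- Let n ≥ 1, let d = ⌊n/2⌋, and let X' be a nonempty subset of the hypercube C = {0,1}^n. Then H_{X'}(d) + H_{X'}(d+1) > |X'|. -/
open Finset in
/-- Kleitman's correlation inequality, applied to the lower set `F` and to the families of small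
and of large sets. -/
theorem card_filter_large_lt_card_filter_small {n : ℕ} {F : Finset (Finset (Fin n))}
    (hF : IsLowerSet (F : Set (Finset (Fin n)))) (hne : F.Nonempty) :
    #{S ∈ F | n / 2 + 2 ≤ #S} < #{S ∈ F | #S ≤ n / 2} := by
  set L : Finset (Finset (Fin n)) := {S | #S ≤ n / 2} with hL
  set U : Finset (Finset (Fin n)) := {S | n / 2 + 2 ≤ #S} with hU
  have hLl : IsLowerSet (L : Set (Finset (Fin n))) := by
    intro a b hba ha
    simp only [hL, coe_filter, mem_univ, true_and, Set.mem_ofPred_eq] at ha ⊢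
    exact (card_le_card hba).trans ha
  have hUu : IsUpperSet (U : Set (Finset (Fin n))) := by
    intro a b hab ha
    simp only [hU, coe_filter, mem_univ, true_and, Set.mem_ofPred_eq] at ha ⊢
    exact ha.trans (card_le_card hab)
  have hUL : #U < #L := by
    obtain ⟨T, -, hT⟩ := exists_subset_card_eq (s := (univ : Finset (Fin n))) (n := n / 2)
      (by simpa using Nat.div_le_self n 2)
    have hsub : U.image compl ⊂ L := by
      refine (ssubset_iff_of_subset ?_).2 ⟨T, by simp [hL, hT], ?_⟩
      · intro S hS
        obtain ⟨R, hR, rfl⟩ := mem_image.1 hS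
        simp only [hU, hL, mem_filter, mem_univ, true_and, card_compl, Fintype.card_fin] at hR ⊢
        omega
      · intro hTm
        obtain ⟨R, hR, rfl⟩ := mem_image.1 hTm
        simp only [hU, mem_filter, mem_univ, true_and, card_compl, Fintype.card_fin] at hR hT
        have hRn : #R ≤ n := by simpa using card_le_univ R
        omega
    simpa [card_image_of_injective _ compl_injective] using card_lt_card hsub
  have h1 := hF.le_card_inter_finset hLl
  have h2 := hF.card_inter_le_finset hUu
  have e1 : F ∩ L = {S ∈ F | #S ≤ n / 2} := by ext; simp [hL]
  have e2 : F ∩ U = {S ∈ F | n / 2 + 2 ≤ #S} := by ext; simp [hU]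
  rw [e1] at h1
  rw [e2] at h2
  have h3 : #F * #U < #F * #L := Nat.mul_lt_mul_of_pos_left hUL hne.card_pos
  exact lt_of_mul_lt_mul_left (h2.trans_lt (h3.trans_le h1)) (Nat.zero_le _)

open Finset in
/-- Numbering of the finite subsets of `Fin n` by their binary expansions. -/
def binaryCode {n : ℕ} (S : Finset (Fin n)) : ℕ := ∑ i ∈ S, 2 ^ (i : ℕ)

theorem binaryCode_injective {n : ℕ} : Function.Injective (binaryCode (n := n)) := by
  intro S T h
  apply Finset.map_injective Fin.valEmbedding
  apply Finset.geomSum_injective le_rfl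
  simpa [binaryCode] using h

theorem binaryCode_insert {n : ℕ} {S : Finset (Fin n)} {i : Fin n} (hi : i ∉ S) :
    binaryCode (insert i S) = 2 ^ (i : ℕ) + binaryCode S :=
  Finset.sum_insert hi

theorem binaryCode_insert_lt {n : ℕ} {S T : Finset (Fin n)} {i : Fin n} (hi : i ∉ S)
    (h : binaryCode T < binaryCode S) :
    binaryCode (insert i T) < binaryCode (insert i S) := by
  rw [binaryCode_insert hi]
  by_cases hT : i ∈ T
  · rw [Finset.insert_eq_of_mem hT]
    exact h.trans_le (Nat.le_add_left _ _)
  · rw [binaryCode_insert hT]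
    omega

section Greedy

variable {ι V : Type*} [AddCommGroup V] [Module ℝ V]

/-- The indices whose vector is not in the span of the vectors of smaller weight. -/
def standardIndices (w : ι → ℕ) (v : ι → V) : Set ι :=
  {i | v i ∉ Submodule.span ℝ (v '' {j | w j < w i})}

theorem linearIndepOn_of_subset_standardIndices {w : ι → ℕ} (hw : Function.Injective w)
    {v : ι → V} (s : Finset ι) (hs : (s : Set ι) ⊆ standardIndices w v) :
    LinearIndepOn ℝ v (s : Set ι) := by
  classical
  induction s using Finset.induction_on_max_value w with
  | empty => simp
  | insert a s ha hmax ih =>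
    rw [Finset.coe_insert] at hs ⊢
    refine (ih ((Set.subset_insert _ _).trans hs)).insert fun h => hs (Set.mem_insert _ _) ?_
    refine Submodule.span_mono (Set.image_mono fun j hj => ?_) h
    exact lt_of_le_of_ne (hmax j hj) fun e => ha (hw e ▸ hj)

theorem mem_span_standardIndices (w : ι → ℕ) (v : ι → V) (i : ι) :
    v i ∈ Submodule.span ℝ (v '' standardIndices w v) := by
  induction h : w i using Nat.strong_induction_on generalizing i with
  | _ k ih =>
    by_cases hi : i ∈ standardIndices w v
    · exact Submodule.subset_span ⟨i, hi, rfl⟩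
    · refine Submodule.span_le.2 ?_ (not_not.1 hi)
      rintro _ ⟨j, hj, rfl⟩
      exact ih (w j) (h ▸ hj) j rfl

end Greedy

/-- The squarefree monomial `∏ i ∈ S, x i` as a function on `X`. -/
def monomialOn {n : ℕ} (X : Set (Fin n → ℝ)) (S : Finset (Fin n)) : X → ℝ :=
  fun x => ∏ i ∈ S, (x : Fin n → ℝ) i

theorem mul_monomialOn {n : ℕ} {X : Set (Fin n → ℝ)} (hX : X ⊆ cube n) (S : Finset (Fin n))
    (i : Fin n) : (fun x : X => (x : Fin n → ℝ) i) * monomialOn X S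
      = monomialOn X (insert i S) := by
  funext x
  by_cases hi : i ∈ S
  · rw [Finset.insert_eq_of_mem hi]
    rcases hX x.2 i with h | h
    · simp [monomialOn, h, Finset.prod_eq_zero hi h]
    · simp [monomialOn, h]
  · simp [monomialOn, Finset.prod_insert hi]

theorem isLowerSet_standardIndices_monomialOn {n : ℕ} {X : Set (Fin n → ℝ)} (hX : X ⊆ cube n) :
    IsLowerSet (standardIndices binaryCode (monomialOn X)) := by
  have key : ∀ (S : Finset (Fin n)) (i : Fin n), i ∉ S →
      insert i S ∈ standardIndices binaryCode (monomialOn X) →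
      S ∈ standardIndices binaryCode (monomialOn X) := by
    intro S i hi hS hmem
    apply hS
    rw [← mul_monomialOn hX]
    have h := Submodule.mem_map_of_mem
      (f := LinearMap.mulLeft ℝ (fun x : X => (x : Fin n → ℝ) i)) hmem
    rw [Submodule.map_span] at h
    refine Submodule.span_mono ?_ h
    rintro _ ⟨_, ⟨T, hT, rfl⟩, rfl⟩
    exact ⟨insert i T, binaryCode_insert_lt hi hT, (mul_monomialOn hX T i).symm⟩
  intro A B hBA hA
  have hU : ∀ R : Finset (Fin n), Disjoint R B →
      B ∪ R ∈ standardIndices binaryCode (monomialOn X) →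
      B ∈ standardIndices binaryCode (monomialOn X) := by
    intro R
    induction R using Finset.induction_on with
    | empty => simp
    | insert a R ha ih =>
      intro hd hm
      rw [Finset.disjoint_insert_left] at hd
      rw [Finset.union_insert] at hm
      exact ih hd.2 (key _ a (by simp [ha, hd.1]) hm)
  refine hU (A \ B) Finset.sdiff_disjoint ?_
  rwa [Finset.union_sdiff_of_subset hBA]

theorem span_range_monomialOn {n : ℕ} {X : Set (Fin n → ℝ)} (hX : X ⊆ cube n) [Finite X] :
    Submodule.span ℝ (Set.range (monomialOn X)) = ⊤ := by
  classical
  rw [eq_top_iff, ← (Pi.basisFun ℝ X).span_eq, Submodule.span_le]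
  rintro _ ⟨x, rfl⟩
  have hx : (Pi.basisFun ℝ X) x = ∑ T ∈ Finset.univ.powerset,
      ((∏ i ∈ T, (2 * (x : Fin n → ℝ) i - 1)) * ∏ i ∈ Finset.univ \ T, (1 - (x : Fin n → ℝ) i)) •
        monomialOn X T := by
    funext y
    have hy : (Pi.basisFun ℝ X) x y = ∏ i, ((2 * (x : Fin n → ℝ) i - 1) * (y : Fin n → ℝ) i
        + (1 - (x : Fin n → ℝ) i)) := by
      rw [Pi.basisFun_apply]
      by_cases hxy : y = x
      · subst hxy
        rw [Pi.single_eq_same, Finset.prod_eq_one]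
        intro i _
        rcases hX y.2 i with h | h <;> rw [h] <;> norm_num
      · rw [Pi.single_eq_of_ne hxy]
        obtain ⟨i, hi⟩ := Function.ne_iff.1 (Subtype.coe_injective.ne hxy)
        refine (Finset.prod_eq_zero (Finset.mem_univ i) ?_).symm
        rcases hX y.2 i with h | h <;> rcases hX x.2 i with h' | h' <;> rw [h, h'] at hi ⊢ <;>
          first | exact absurd rfl hi | norm_num
    rw [hy, Finset.prod_add, Finset.sum_apply]
    refine Finset.sum_congr rfl fun T _ => ?_
    simp only [Finset.prod_mul_distrib, Pi.smul_apply, smul_eq_mul, monomialOn]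
    ring
  rw [hx]
  exact Submodule.sum_mem _ fun T _ => Submodule.smul_mem _ _ (Submodule.subset_span ⟨T, rfl⟩)

theorem card_le_hilbert {n t : ℕ} {X : Set (Fin n → ℝ)} [Finite X] (s : Finset (Finset (Fin n)))
    (hs : LinearIndepOn ℝ (monomialOn X) (s : Set (Finset (Fin n))))
    (hst : ∀ S ∈ s, S.card ≤ t) : s.card ≤ hilbert n X t := by
  have h := finrank_span_eq_card (R := ℝ) (b := fun S : s => monomialOn X S) hs
  rw [Fintype.card_coe] at h
  rw [← h]
  refine Submodule.finrank_mono (Submodule.span_mono ?_)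
  rintro _ ⟨S, rfl⟩
  refine ⟨∏ i ∈ S.1, MvPolynomial.X i, ?_, fun x => by simp [monomialOn]⟩
  refine (MvPolynomial.totalDegree_finsetProd _ _).trans ?_
  simpa using hst S S.2

theorem finite_cube (n : ℕ) : (cube n).Finite := by
  refine (Set.Finite.pi' (t := fun _ : Fin n => ({0, 1} : Set ℝ)) fun _ => by simp).subset ?_
  intro x hx i
  simpa using hx i

theorem stmt11 (n d : ℕ) (hn : 1 ≤ n) (hd : d = n / 2)
    (X' : Set (Fin n → ℝ)) (hne : X'.Nonempty) (hsub : X' ⊆ cube n) :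
    X'.ncard < hilbert n X' d + hilbert n X' (d + 1) := by
  classical
  have : Finite X' := (finite_cube n).subset hsub
  have : Fintype X' := Fintype.ofFinite X'
  set F : Finset (Finset (Fin n)) :=
    (standardIndices binaryCode (monomialOn X')).toFinset with hFdef
  have hF : (F : Set (Finset (Fin n))) = standardIndices binaryCode (monomialOn X') := by
    simp [hFdef]
  have hcard : X'.ncard ≤ F.card := by
    have htop : Submodule.span ℝ ((F.image (monomialOn X') : Finset (X' → ℝ)) : Set (X' → ℝ))
        = ⊤ := by
      rw [Finset.coe_image, hF, eq_top_iff, ← span_range_monomialOn hsub, Submodule.span_le]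
      rintro _ ⟨S, rfl⟩
      exact mem_span_standardIndices _ _ S
    have h := finrank_span_finset_le_card (R := ℝ) (F.image (monomialOn X'))
    rw [Set.finrank, htop, finrank_top, Module.finrank_fintype_fun_eq_card,
      ← Nat.card_eq_fintype_card, Nat.card_coe_set_eq] at h
    exact h.trans Finset.card_image_le
  have hFne : F.Nonempty := by
    rw [← Finset.card_pos]
    exact ((Set.ncard_pos (Set.toFinite X')).2 hne).trans_le hcard
  have hbound : ∀ t, (F.filter fun S => S.card ≤ t).card ≤ hilbert n X' t := fun t =>
    card_le_hilbert _ (linearIndepOn_of_subset_standardIndices binaryCode_injective _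
      (hF ▸ Finset.coe_subset.2 (Finset.filter_subset _ _))) fun S hS => (Finset.mem_filter.1 hS).2
  have hlt := card_filter_large_lt_card_filter_small
    (hF ▸ isLowerSet_standardIndices_monomialOn hsub) hFne
  have hsplit := Finset.card_filter_add_card_filter_not (s := F) fun S => S.card ≤ d + 1
  have hlarge : F.filter (fun S => ¬ S.card ≤ d + 1) = F.filter fun S => n / 2 + 2 ≤ S.card :=
    Finset.filter_congr fun S _ => by omega
  rw [hlarge] at hsplit
  rw [← hd] at hlt hsplit
  have h1 := hbound d
  have h2 := hbound (d + 1)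
  omega
end

section
/- Let k and i be natural numbers with i ≤ n − 2k, let t ∈ ℝ, and let f ∈ ℝ[x_1,…,x_n] be a homogeneous multilinear polynomial of degree k, i.e., a real linear combination of monomials x_{j_1}⋯x_{j_k} with distinct indices. If (t − x_1 − … − x_n)^i · f(x) = 0 for every x ∈ {0,1}^n, then f = 0. -/
open Finset in
/-- Evaluation at the indicator vector of the complement of `C` sums the coefficients of the
monomials whose support avoids `C`. -/
theorem eval_indicator_compl {σ R : Type*} [Fintype σ] [DecidableEq σ] [CommRing R]
    (f : MvPolynomial σ R) (C : Finset σ) :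
    MvPolynomial.eval (fun j => if j ∈ C then 0 else 1) f =
      ∑ m ∈ f.support, f.coeff m * if Disjoint C m.support then 1 else 0 := by
  rw [MvPolynomial.eval_eq]
  refine sum_congr rfl fun m _ => ?_
  congr 1
  split_ifs with h
  · refine prod_eq_one fun j hj => ?_
    rw [if_neg (disjoint_right.1 h hj), one_pow]
  · obtain ⟨j, hjC, hj⟩ := not_disjoint_iff.1 h
    refine prod_eq_zero hj ?_
    rw [if_pos hjC, zero_pow (Finsupp.mem_support_iff.1 hj)]

open Finset in
theorem sum_powerset_neg_one_pow_card_disjoint {σ R : Type*} [DecidableEq σ] [CommRing R]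
    (S U : Finset σ) :
    ∑ C ∈ S.powerset, (-1 : R) ^ #C * (if Disjoint C U then 1 else 0) =
      if S ⊆ U then 1 else 0 := by
  have key := prod_add_one (s := S) (f := fun j => if j ∈ U then (0 : R) else -1)
  have hC (C : Finset σ) : ∏ j ∈ C, (if j ∈ U then (0 : R) else -1) =
      (-1 : R) ^ #C * (if Disjoint C U then 1 else 0) := by
    split_ifs with h
    · rw [mul_one, ← prod_const]
      exact prod_congr rfl fun j hj => if_neg (disjoint_left.1 h hj)
    · obtain ⟨j, hjC, hj⟩ := not_disjoint_iff.1 h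
      rw [mul_zero]
      exact prod_eq_zero hjC (if_pos hj)
  rw [sum_congr rfl fun C _ => (hC C).symm, ← key]
  split_ifs with h
  · exact prod_eq_one fun j hj => by simp [h hj]
  · obtain ⟨j, hjS, hj⟩ := not_subset.1 h
    exact prod_eq_zero hjS (by simp [hj])

theorem card_support_of_forall_le_one {σ : Type*} {m : σ →₀ ℕ} (h : ∀ j, m j ≤ 1) :
    m.support.card = m.sum fun _ e => e := by
  rw [Finset.card_eq_sum_ones]
  refine Finset.sum_congr rfl fun j hj => ?_
  have := h j
  have := Finsupp.mem_support_iff.1 hj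
  show 1 = m j
  omega

theorem eq_of_support_eq_of_forall_le_one {σ : Type*} {m m' : σ →₀ ℕ} (h : ∀ j, m j ≤ 1)
    (h' : ∀ j, m' j ≤ 1) (hs : m.support = m'.support) : m = m' := by
  ext j
  have hj : m j ≠ 0 ↔ m' j ≠ 0 := by
    rw [← Finsupp.mem_support_iff, hs, Finsupp.mem_support_iff]
  have := h j
  have := h' j
  omega

open Finset in
theorem stmt12 (n k i : ℕ) (hki : 2 * k + i ≤ n) (t : ℝ)
    (f : MvPolynomial (Fin n) ℝ)
    (hmultilin : ∀ m ∈ f.support, (∀ j, m j ≤ 1) ∧ (m.sum fun _ e => e) = k)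
    (hvanish : ∀ x ∈ cube n, (t - ∑ j, x j) ^ i * MvPolynomial.eval x f = 0) :
    f = 0 := by
  have hcard : ∀ m ∈ f.support, #m.support = k := fun m hm =>
    (card_support_of_forall_le_one (hmultilin m hm).1).trans (hmultilin m hm).2
  have hinj : ∀ m ∈ f.support, ∀ m' ∈ f.support, m.support = m'.support → m = m' :=
    fun m hm m' hm' =>
      eq_of_support_eq_of_forall_le_one (hmultilin m hm).1 (hmultilin m' hm').1
  have hzero (C : Finset (Fin n)) (hC : i = 0 ∨ t ≠ (#Cᶜ : ℝ)) :
      ∑ m ∈ f.support, f.coeff m * (if Disjoint C m.support then 1 else 0) = 0 := by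
    have hx := hvanish (fun j => if j ∈ C then 0 else 1) fun j => by
      by_cases h : j ∈ C <;> simp [h]
    have hsum : ∑ j, (if j ∈ C then (0 : ℝ) else 1) = #Cᶜ := by
      rw [card_eq_sum_ones, Nat.cast_sum, ← sum_compl_add_sum C, add_comm,
        sum_eq_zero (s := C) fun j hj => if_pos hj, zero_add]
      exact sum_congr rfl fun j hj => by simp [mem_compl.1 hj]
    rw [← eval_indicator_compl]
    refine (mul_eq_zero.1 hx).resolve_left ?_
    rw [hsum]
    rcases hC with rfl | hC
    · simp
    · exact pow_ne_zero _ (sub_ne_zero.2 hC)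
  by_contra hf
  obtain ⟨m, hm⟩ := Finset.nonempty_iff_ne_empty.2 (mt MvPolynomial.support_eq_empty.1 hf)
  have hcoeff : f.coeff m ≠ 0 := MvPolynomial.mem_support_iff.1 hm
  by_cases h : i = 0 ∨ t ≠ k
  · have hsum := hzero m.supportᶜ (by rwa [compl_compl, hcard m hm])
    rw [sum_eq_single m] at hsum
    · simp [hcoeff, disjoint_compl_left] at hsum
    · intro m' hm' hne
      rw [if_neg, mul_zero]
      intro hd
      refine hne (hinj _ hm' _ hm (eq_of_subset_of_card_le ?_ ?_))
      · exact disjoint_compl_left_iff.1 hd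
      · rw [hcard m hm, hcard m' hm']
    · exact fun h => (h hm).elim
  · push Not at h
    obtain ⟨hi, rfl⟩ := h
    have hsum : ∑ C ∈ m.support.powerset, (-1 : ℝ) ^ #C *
        ∑ m' ∈ f.support, f.coeff m' * (if Disjoint C m'.support then 1 else 0) = 0 := by
      refine sum_eq_zero fun C hC => ?_
      rw [hzero C (Or.inr ?_), mul_zero]
      have hle := card_le_card (mem_powerset.1 hC)
      rw [hcard m hm] at hle
      rw [card_compl, Fintype.card_fin, Ne, Nat.cast_inj]
      omega
    simp_rw [mul_sum, mul_left_comm _ (f.coeff _)] at hsum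
    rw [sum_comm] at hsum
    simp_rw [← mul_sum, sum_powerset_neg_one_pow_card_disjoint] at hsum
    rw [sum_eq_single m] at hsum
    · simp [hcoeff] at hsum
    · intro m' hm' hne
      rw [if_neg, mul_zero]
      intro hd
      refine hne (hinj _ hm _ hm' (eq_of_subset_of_card_le hd ?_)).symm
      rw [hcard m hm, hcard m' hm']
    · exact fun h => (h hm).elim
end

section
/- Fix a natural number t with 0 ≤ t ≤ n and let T = {x ∈ {0,1}^n : x_1+…+x_n = t}. Then every polynomial p ∈ ℝ[x_1,…,x_n] that agrees on {0,1}^n with the indicator function χ_T (i.e., p(x) = 1 for x ∈ T and p(x) = 0 for x ∈ {0,1}^n \ T) has total degree at least n. -/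
open Finset in
/-- The alternating sum over the hypercube of a monomial that misses some variable vanishes. -/
theorem alternating_sum_monomial_eq_zero {ι R : Type*} [Fintype ι] [DecidableEq ι] [CommRing R]
    (d : ι → ℕ) {j : ι} (hj : d j = 0) :
    ∑ s : Finset ι, (-1 : R) ^ #s * ∏ i, (if i ∈ s then (1 : R) else 0) ^ d i = 0 := by
  have h : ∏ i, ((-1 : R) + 0 ^ d i) = 0 := prod_eq_zero (mem_univ j) (by simp [hj])
  rw [prod_add, powerset_univ] at h
  refine (sum_congr rfl fun s _ => ?_).trans h
  rw [prod_const]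
  congr 1
  rw [← prod_sdiff (subset_univ s)]
  have h₁ : ∏ i ∈ s, (if i ∈ s then (1 : R) else 0) ^ d i = 1 :=
    prod_eq_one fun i hi => by simp [hi]
  rw [h₁, mul_one]
  exact prod_congr rfl fun i hi => by rw [if_neg (mem_sdiff.1 hi).2]

open Finset in
/-- The alternating sum over the hypercube of a polynomial of degree smaller than the number of
variables vanishes. -/
theorem alternating_sum_eval_eq_zero {ι R : Type*} [Fintype ι] [DecidableEq ι] [CommRing R]
    (p : MvPolynomial ι R) (hp : p.totalDegree < Fintype.card ι) :
    ∑ s : Finset ι, (-1 : R) ^ #s * MvPolynomial.eval (fun i => if i ∈ s then (1 : R) else 0) p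
      = 0 := by
  simp_rw [MvPolynomial.eval_eq', mul_sum]
  rw [sum_comm]
  refine sum_eq_zero fun d hd => ?_
  obtain ⟨j, hj⟩ : ∃ j, d j = 0 := by
    by_contra! h
    have h₁ : ∑ i, d i ≤ p.totalDegree := by
      simpa [Finsupp.sum_fintype] using MvPolynomial.le_totalDegree hd
    have h₂ : ∑ _i : ι, 1 ≤ ∑ i, d i := sum_le_sum fun i _ => Nat.one_le_iff_ne_zero.2 (h i)
    simp only [sum_const, card_univ, smul_eq_mul, mul_one] at h₂
    omega
  simp_rw [mul_left_comm _ (p.coeff d)]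
  rw [← mul_sum, alternating_sum_monomial_eq_zero d hj, mul_zero]

theorem stmt13 (n t : ℕ) (ht : t ≤ n) (p : MvPolynomial (Fin n) ℝ)
    (hp : ∀ x ∈ cube n,
      MvPolynomial.eval x p = if (∑ i, x i) = (t : ℝ) then 1 else 0) :
    n ≤ p.totalDegree := by
  by_contra! hlt
  have h := alternating_sum_eval_eq_zero p (by simpa using hlt)
  have heval : ∀ s : Finset (Fin n),
      (-1 : ℝ) ^ s.card * MvPolynomial.eval (fun i => if i ∈ s then (1 : ℝ) else 0) p
        = if s.card = t then (-1) ^ t else 0 := by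
    intro s
    rw [hp _ fun i => by by_cases hi : i ∈ s <;> simp [hi]]
    simp only [Finset.sum_boole, Finset.filter_univ_mem, Nat.cast_inj]
    split_ifs with hs <;> simp [hs]
  simp_rw [heval] at h
  rw [← Finset.sum_filter, Finset.sum_const, Finset.univ_filter_card_eq,
    Finset.card_powersetCard, Finset.card_univ, Fintype.card_fin, nsmul_eq_mul] at h
  have hchoose : (n.choose t : ℝ) ≠ 0 := by exact_mod_cast (Nat.choose_pos ht).ne'
  exact mul_ne_zero hchoose (pow_ne_zero t (by norm_num)) h
end

section
/- Let C = {0,1}^n and let t be a natural number with 0 ≤ t ≤ n. Then H_C(t) = Σ_{i=0}^{t} binom(n,i); in particular H_C(n) = 2^n. -/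
/-- The restriction to the cube of the squarefree monomial `∏ i ∈ S, X i`. -/
noncomputable def cubeMonomial (n : ℕ) (S : Finset (Fin n)) : cube n → ℝ :=
  fun x => ∏ i ∈ S, (x : Fin n → ℝ) i

/-- The vertex of the cube with support `T`. -/
noncomputable def cubeVertex {n : ℕ} (T : Finset (Fin n)) : cube n :=
  ⟨fun i => if i ∈ T then 1 else 0, fun i => by by_cases h : i ∈ T <;> simp [h]⟩

theorem cubeMonomial_cubeVertex {n : ℕ} (S T : Finset (Fin n)) :
    cubeMonomial n S (cubeVertex T) = if S ⊆ T then 1 else 0 := by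
  simp only [cubeMonomial, cubeVertex, Finset.prod_ite_zero, Finset.prod_const_one]
  exact if_congr Iff.rfl rfl rfl

theorem linearIndependent_cubeMonomial (n : ℕ) : LinearIndependent ℝ (cubeMonomial n) := by
  rw [Fintype.linearIndependent_iff]
  intro c hc T
  induction T using Finset.strongInduction with
  | H T ih =>
    have h := congrFun hc (cubeVertex T)
    simp only [Finset.sum_apply, Pi.smul_apply, cubeMonomial_cubeVertex, smul_eq_mul,
      Pi.zero_apply] at h
    rw [Finset.sum_eq_single T] at h
    · simpa using h
    · intro S _ hS
      by_cases hST : S ⊆ T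
      · simp [ih S (hST.ssubset_of_ne hS)]
      · simp [hST]
    · simp

theorem eval_eq_sum_cubeMonomial {n : ℕ} (p : MvPolynomial (Fin n) ℝ) (x : cube n) :
    MvPolynomial.eval (x : Fin n → ℝ) p =
      ∑ d ∈ p.support, p.coeff d * cubeMonomial n d.support x := by
  rw [MvPolynomial.eval_eq]
  refine Finset.sum_congr rfl fun d _ => congrArg _ (Finset.prod_congr rfl fun i hi => ?_)
  rcases x.2 i with h | h
  · rw [h, zero_pow (Finsupp.mem_support_iff.mp hi)]
  · rw [h, one_pow]

theorem card_support_le_degree {σ : Type*} (d : σ →₀ ℕ) :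
    d.support.card ≤ d.sum fun _ e => e := by
  rw [Finset.card_eq_sum_ones]
  exact Finset.sum_le_sum fun i hi => Nat.one_le_iff_ne_zero.mpr (Finsupp.mem_support_iff.mp hi)

theorem span_cube_eq_span_cubeMonomial (n t : ℕ) :
    Submodule.span ℝ {f : cube n → ℝ | ∃ p : MvPolynomial (Fin n) ℝ, p.totalDegree ≤ t ∧
      ∀ x : cube n, f x = MvPolynomial.eval (x : Fin n → ℝ) p} =
    Submodule.span ℝ (Set.range fun S : {S : Finset (Fin n) // S.card ≤ t} =>
      cubeMonomial n S) := by
  apply le_antisymm <;> rw [Submodule.span_le]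
  · rintro f ⟨p, hp, hf⟩
    have hfp : f = ∑ d ∈ p.support, p.coeff d • cubeMonomial n d.support := by
      ext x
      simp [hf, eval_eq_sum_cubeMonomial]
    rw [hfp]
    refine Submodule.sum_mem _ fun d hd => Submodule.smul_mem _ _ (Submodule.subset_span ?_)
    exact ⟨⟨d.support, (card_support_le_degree d).trans
      ((MvPolynomial.le_totalDegree hd).trans hp)⟩, rfl⟩
  · rintro _ ⟨⟨S, hS⟩, rfl⟩
    refine Submodule.subset_span ⟨∏ i ∈ S, MvPolynomial.X i, ?_, fun x => ?_⟩
    · refine (MvPolynomial.totalDegree_finsetProd _ _).trans ?_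
      simpa using hS
    · simp [cubeMonomial]

theorem card_finset_card_le (n t : ℕ) :
    Fintype.card {S : Finset (Fin n) // S.card ≤ t} =
      ∑ i ∈ Finset.range (t + 1), n.choose i := by
  rw [Fintype.card_subtype, Finset.card_eq_sum_card_fiberwise (f := Finset.card)
    (t := Finset.range (t + 1)) (fun S hS => by simpa [Nat.lt_succ_iff] using hS)]
  refine Finset.sum_congr rfl fun i hi => ?_
  rw [Finset.filter_filter]
  calc _ = (Finset.powersetCard i (Finset.univ : Finset (Fin n))).card := by
        congr 1
        ext S
        simp only [Finset.mem_filter, Finset.mem_univ, true_and, Finset.mem_powersetCard,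
          Finset.subset_univ]
        have := Finset.mem_range.mp hi
        omega
    _ = n.choose i := by simp

theorem hilbert_cube (n t : ℕ) :
    hilbert n (cube n) t = ∑ i ∈ Finset.range (t + 1), n.choose i := by
  rw [hilbert, span_cube_eq_span_cubeMonomial, finrank_span_eq_card, card_finset_card_le]
  exact (linearIndependent_cubeMonomial n).comp _ Subtype.val_injective

theorem stmt14 (n t : ℕ) (ht : t ≤ n) :
    hilbert n (cube n) t = ∑ i ∈ Finset.range (t + 1), n.choose i ∧
    hilbert n (cube n) n = 2 ^ n := by
  exact ⟨hilbert_cube n t, (hilbert_cube n n).trans (Nat.sum_range_choose n)⟩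
end

section
/- Let t be a natural number with 2t ≤ n, let C = {0,1}^n, let T = {x ∈ C : x_1+…+x_n = t}, and let ℓ(x) = t − (x_1+…+x_n). Let h : C → ℝ be invariant under all permutations of the coordinates, not identically zero on C, and suppose h(x) = h_1(x)² + … + h_m(x)² for all x ∈ C, where each h_j is a polynomial of total degree at most t. Then there exist a natural number a and a function q : C → ℝ that is invariant under all permutations of the coordinates, satisfies q(x) > 0 for every x ∈ T, and satisfies h(x) = ℓ(x)^{2a} q(x) for all x ∈ C and deg_C(q) = deg_C(h) − 2a. -/
open Finset in
/-- Counting pairs `(S, i)` with `i ∈ S ⊆ X`, `#S = d + 1`, by the set `S \ {i}`. -/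
lemma sum_powersetCard_succ_sum_erase {α : Type*} [DecidableEq α] (c : Finset α → ℝ) (d : ℕ)
    (X : Finset α) :
    ∑ S ∈ X.powersetCard (d + 1), ∑ i ∈ S, c (S.erase i) =
      ((#X : ℝ) - d) * ∑ S ∈ X.powersetCard d, c S := by
  have hcount : ∑ S ∈ X.powersetCard (d + 1), ∑ i ∈ S, c (S.erase i) =
      ∑ S ∈ X.powersetCard d, ∑ _i ∈ X \ S, c S := by
    rw [Finset.sum_sigma', Finset.sum_sigma']
    refine Finset.sum_bij' (fun p _ => ⟨p.1.erase p.2, p.2⟩) (fun p _ => ⟨insert p.2 p.1, p.2⟩)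
      ?_ ?_ ?_ ?_ ?_
    · rintro ⟨S, i⟩ h
      simp only [mem_sigma, mem_powersetCard, mem_sdiff] at h ⊢
      obtain ⟨⟨hS, hc⟩, hi⟩ := h
      refine ⟨⟨(erase_subset _ _).trans hS, ?_⟩, hS hi, notMem_erase _ _⟩
      rw [card_erase_of_mem hi, hc, Nat.add_sub_cancel]
    · rintro ⟨S, i⟩ h
      simp only [mem_sigma, mem_powersetCard, mem_sdiff] at h ⊢
      obtain ⟨⟨hS, hc⟩, hi, hiS⟩ := h
      exact ⟨⟨insert_subset hi hS, by rw [card_insert_of_notMem hiS, hc]⟩, mem_insert_self _ _⟩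
    · rintro ⟨S, i⟩ h
      simp only [mem_sigma] at h
      simp [insert_erase h.2]
    · rintro ⟨S, i⟩ h
      simp only [mem_sigma, mem_sdiff] at h
      simp [erase_insert h.2.2]
    · rintro ⟨S, i⟩ _
      rfl
  rw [hcount, mul_sum]
  refine sum_congr rfl fun S hS => ?_
  rw [mem_powersetCard] at hS
  rw [sum_const, nsmul_eq_mul, card_sdiff_of_subset hS.1,
    Nat.cast_sub (card_le_card hS.1), hS.2]

open Finset in
/-- Modulo `t - #X`, a multilinear form of degree at most `d ≤ t` is homogeneous of degree `d`. -/
lemma exists_homogeneous_add_mul {α : Type*} [DecidableEq α] (c : Finset α → ℝ) {d t : ℕ}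
    (hd : d ≤ t) :
    ∃ c₁ c₂ : Finset α → ℝ, ∀ X : Finset α,
      ∑ k ∈ range (d + 1), ∑ S ∈ X.powersetCard k, c S =
        ∑ S ∈ X.powersetCard d, c₁ S +
          ((t : ℝ) - #X) * ∑ k ∈ range d, ∑ S ∈ X.powersetCard k, c₂ S := by
  induction d with
  | zero => exact ⟨c, 0, fun X => by simp⟩
  | succ d ih =>
    obtain ⟨c₁, c₂, h⟩ := ih (by omega)
    have htd : (t : ℝ) - d ≠ 0 := by
      have : (d : ℝ) < t := by exact_mod_cast hd
      linarith
    refine ⟨fun S => c S + ((t : ℝ) - d)⁻¹ * ∑ i ∈ S, c₁ (S.erase i),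
      fun S => if #S = d then ((t : ℝ) - d)⁻¹ * c₁ S else c₂ S, fun X => ?_⟩
    have hlow : ∑ k ∈ range d, ∑ S ∈ X.powersetCard k,
        (if #S = d then ((t : ℝ) - d)⁻¹ * c₁ S else c₂ S) =
        ∑ k ∈ range d, ∑ S ∈ X.powersetCard k, c₂ S := by
      refine sum_congr rfl fun k hk => sum_congr rfl fun S hS => if_neg ?_
      rw [(mem_powersetCard.1 hS).2]
      exact (mem_range.1 hk).ne
    have htop : ∑ S ∈ X.powersetCard d, (if #S = d then ((t : ℝ) - d)⁻¹ * c₁ S else c₂ S) =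
        ((t : ℝ) - d)⁻¹ * ∑ S ∈ X.powersetCard d, c₁ S := by
      rw [mul_sum]
      exact sum_congr rfl fun S hS => if_pos (mem_powersetCard.1 hS).2
    rw [sum_range_succ, h, sum_range_succ _ d, hlow, htop, sum_add_distrib, ← mul_sum,
      sum_powersetCard_succ_sum_erase]
    field_simp
    ring

open Finset in
/-- Full column rank of the inclusion matrix of `d`-sets versus `t`-sets (Gottlieb). -/
lemma eq_zero_of_sum_powersetCard_eq_zero_s16 {α : Type*} [DecidableEq α] (d t : ℕ) (V : Finset α)
    (hdt : d ≤ t) (hV : d + t ≤ #V) (c : Finset α → ℝ)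
    (h : ∀ X ⊆ V, #X = t → ∑ S ∈ X.powersetCard d, c S = 0) :
    ∀ S ⊆ V, #S = d → c S = 0 := by
  induction d generalizing t V c with
  | zero =>
    intro S _ hS
    obtain ⟨X, hXV, hX⟩ := exists_subset_card_eq (s := V) (n := t) (by omega)
    rw [card_eq_zero.1 hS]
    simpa using h X hXV hX
  | succ d ih =>
    obtain ⟨t, rfl⟩ : ∃ s, t = s + 1 := ⟨t - 1, by omega⟩
    have hswap : ∀ i ∈ V, ∀ j ∈ V, i ≠ j → ∀ S ⊆ (V.erase i).erase j, #S = d →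
        c (insert i S) - c (insert j S) = 0 := by
      intro i hi j hj hij
      refine ih t ((V.erase i).erase j) (by omega) ?_
        (fun S => c (insert i S) - c (insert j S)) ?_
      · rw [card_erase_of_mem (mem_erase.2 ⟨hij.symm, hj⟩), card_erase_of_mem hi]
        omega
      · intro X hX hXt
        have hiX : i ∉ X := fun hx => by simpa using hX hx
        have hjX : j ∉ X := fun hx => by simpa using hX hx
        have hXV : X ⊆ V := hX.trans ((erase_subset _ _).trans (erase_subset _ _))
        have key : ∀ k ∈ V, k ∉ X → ∑ S ∈ X.powersetCard (d + 1), c S +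
            ∑ S ∈ X.powersetCard d, c (insert k S) = 0 := by
          intro k hk hkX
          have h0 := h (insert k X) (insert_subset hk hXV) (by rw [card_insert_of_notMem hkX, hXt])
          rw [powersetCard_succ_insert hkX, sum_union, sum_image] at h0
          · exact h0
          · intro A hA B hB hAB
            have hkA : k ∉ A := fun hx => hkX ((mem_powersetCard.1 hA).1 hx)
            have hkB : k ∉ B := fun hx => hkX ((mem_powersetCard.1 hB).1 hx)
            rw [← erase_insert hkA, ← erase_insert hkB, hAB]
          · rw [disjoint_left]
            intro A hA hA'
            obtain ⟨B, _, rfl⟩ := mem_image.1 hA'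
            exact hkX ((mem_powersetCard.1 hA).1 (mem_insert_self _ _))
        rw [sum_sub_distrib]
        linarith [key i hi hiX, key j hj hjX]
    have hconst : ∀ N : ℕ, ∀ A ⊆ V, ∀ B ⊆ V, #A = d + 1 → #B = d + 1 → #(A \ B) = N →
        c A = c B := by
      intro N
      induction N with
      | zero =>
        intro A _ B _ hA hB hAB
        rw [card_eq_zero, sdiff_eq_empty_iff_subset] at hAB
        rw [eq_of_subset_of_card_le hAB (by omega)]
      | succ N ihN =>
        intro A hAV B hBV hA hB hAB
        have hBA : #(B \ A) = #(A \ B) := card_sdiff_comm (by omega)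
        obtain ⟨i, hi⟩ : (A \ B).Nonempty := card_pos.1 (by omega)
        obtain ⟨j, hj⟩ : (B \ A).Nonempty := card_pos.1 (by omega)
        rw [mem_sdiff] at hi hj
        have hij : i ≠ j := fun e => hi.2 (e ▸ hj.1)
        have hjA : j ∉ A.erase i := fun hx => hj.2 (erase_subset _ _ hx)
        have hcard : #(A.erase i) = d := by rw [card_erase_of_mem hi.1, hA, Nat.add_sub_cancel]
        have h1 := hswap i (hAV hi.1) j (hBV hj.1) hij (A.erase i)
          (subset_erase.2 ⟨erase_subset_erase _ hAV, hjA⟩) hcard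
        rw [insert_erase hi.1, sub_eq_zero] at h1
        rw [h1]
        refine ihN _ (insert_subset (hBV hj.1) ((erase_subset _ _).trans hAV)) B hBV
          (by rw [card_insert_of_notMem hjA, hcard]) hB ?_
        rw [insert_sdiff_of_mem _ hj.1, erase_sdiff_comm,
          card_erase_of_mem (mem_sdiff.2 hi), hAB, Nat.add_sub_cancel]
    intro S hSV hS
    obtain ⟨X, hXV, hX⟩ := exists_subset_card_eq (s := V) (n := t + 1) (by omega)
    have h0 := h X hXV hX
    rw [sum_congr rfl fun A hA => hconst _ A ((mem_powersetCard.1 hA).1.trans hXV) S hSV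
      (mem_powersetCard.1 hA).2 hS rfl, sum_const, card_powersetCard, hX, nsmul_eq_mul,
      mul_eq_zero] at h0
    refine h0.resolve_left ?_
    exact_mod_cast (Nat.choose_pos hdt).ne'

/-- The vertex of the cube with support `X`. -/
def vertex {n : ℕ} (X : Finset (Fin n)) : Fin n → ℝ := fun i => if i ∈ X then 1 else 0

lemma vertex_mem_cube {n : ℕ} (X : Finset (Fin n)) : vertex X ∈ cube n := fun i => by
  by_cases h : i ∈ X <;> simp [vertex, h]

lemma exists_vertex_eq {n : ℕ} {x : Fin n → ℝ} (hx : x ∈ cube n) :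
    ∃ X : Finset (Fin n), vertex X = x := by
  classical
  refine ⟨Finset.univ.filter fun i => x i = 1, funext fun i => ?_⟩
  rcases hx i with h | h <;> simp [vertex, h]

lemma sum_vertex {n : ℕ} (X : Finset (Fin n)) : ∑ i, vertex X i = (X.card : ℝ) := by
  simp [vertex]

lemma comp_perm_mem_cube {n : ℕ} {x : Fin n → ℝ} (hx : x ∈ cube n) (σ : Equiv.Perm (Fin n)) :
    (fun i => x (σ i)) ∈ cube n := fun i => hx (σ i)

lemma exists_perm_vertex {n : ℕ} {X Y : Finset (Fin n)} (hXY : X.card = Y.card) :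
    ∃ σ : Equiv.Perm (Fin n), (fun i => vertex Y (σ i)) = vertex X := by
  classical
  let e : {i // i ∈ X} ≃ {i // i ∈ Y} := Finset.equivOfCardEq hXY
  refine ⟨e.extendSubtype, funext fun i => ?_⟩
  by_cases hi : i ∈ X
  · simp [vertex, hi, e.extendSubtype_mem i hi]
  · simp [vertex, hi, e.extendSubtype_not_mem i hi]

open Finset in
lemma eval_vertex_eq_sum {n d : ℕ} (p : MvPolynomial (Fin n) ℝ) (hp : p.totalDegree ≤ d) :
    ∃ c : Finset (Fin n) → ℝ, ∀ X : Finset (Fin n),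
      MvPolynomial.eval (vertex X) p = ∑ k ∈ range (d + 1), ∑ S ∈ X.powersetCard k, c S := by
  refine ⟨fun S => ∑ m ∈ p.support, if m.support = S then p.coeff m else 0, fun X => ?_⟩
  rw [MvPolynomial.eval_eq]
  simp_rw [sum_comm (s := powersetCard _ X)]
  rw [sum_comm]
  refine sum_congr rfl fun m hm => ?_
  simp_rw [sum_ite_eq, mem_powersetCard]
  have hcard : #m.support ≤ d := by
    refine le_trans ?_ ((MvPolynomial.le_totalDegree hm).trans hp)
    rw [Finsupp.sum, card_eq_sum_ones]
    exact sum_le_sum fun i hi => Nat.one_le_iff_ne_zero.2 (Finsupp.mem_support_iff.1 hi)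
  by_cases hX : m.support ⊆ X
  · rw [prod_congr rfl (g := fun _ => (1 : ℝ)) fun i hi => by simp [vertex, hX hi]]
    simp [hX, Nat.lt_succ_of_le hcard]
  · obtain ⟨i, hi, hiX⟩ := not_subset.1 hX
    rw [prod_eq_zero hi (by simp [vertex, hiX, Finsupp.mem_support_iff.1 hi])]
    simp [hX]

open Finset in
lemma exists_eval_vertex_eq {n : ℕ} (d : ℕ) (c : Finset (Fin n) → ℝ) :
    ∃ p : MvPolynomial (Fin n) ℝ, p.totalDegree ≤ d ∧ ∀ X : Finset (Fin n),
      MvPolynomial.eval (vertex X) p = ∑ k ∈ range (d + 1), ∑ S ∈ X.powersetCard k, c S := by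
  refine ⟨∑ k ∈ range (d + 1), ∑ S ∈ univ.powersetCard k,
    MvPolynomial.C (c S) * ∏ i ∈ S, MvPolynomial.X i, ?_, fun X => ?_⟩
  · refine MvPolynomial.totalDegree_finsetSum_le fun k hk =>
      MvPolynomial.totalDegree_finsetSum_le fun S hS => ?_
    refine (MvPolynomial.totalDegree_mul _ _).trans ?_
    rw [MvPolynomial.totalDegree_C, zero_add]
    refine (MvPolynomial.totalDegree_finsetProd _ _).trans ?_
    simp only [MvPolynomial.totalDegree_X, sum_const, smul_eq_mul, mul_one]
    rw [(mem_powersetCard.1 hS).2]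
    exact Nat.lt_succ_iff.1 (mem_range.1 hk)
  · rw [map_sum]
    refine sum_congr rfl fun k _ => ?_
    rw [map_sum]
    refine (sum_subset (powersetCard_mono (subset_univ X)) fun S hS hSX => ?_).symm.trans
      (sum_congr rfl fun S hS => ?_)
    · have hSX' : ¬ S ⊆ X := fun hx => hSX (mem_powersetCard.2 ⟨hx, (mem_powersetCard.1 hS).2⟩)
      obtain ⟨i, hi, hiX⟩ := not_subset.1 hSX'
      rw [map_mul, map_prod, prod_eq_zero hi (by simp [vertex, hiX]), mul_zero]
    · rw [map_mul, map_prod, prod_eq_one fun i hi => by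
        simp [vertex, (mem_powersetCard.1 hS).1 hi]]
      simp

open Finset in
/-- A polynomial of degree at most `d ≤ t ≤ n - t` vanishing on the `t`-th slice of the cube is
a multiple of `t - ∑ x_i` there. -/
lemma eval_vertex_of_vanish {n d t : ℕ} (hd : d ≤ t) (ht : 2 * t ≤ n)
    (p : MvPolynomial (Fin n) ℝ) (hp : p.totalDegree ≤ d)
    (h0 : ∀ X : Finset (Fin n), #X = t → MvPolynomial.eval (vertex X) p = 0) :
    ∃ c : Finset (Fin n) → ℝ, ∀ X : Finset (Fin n), MvPolynomial.eval (vertex X) p =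
      ((t : ℝ) - #X) * ∑ k ∈ range d, ∑ S ∈ X.powersetCard k, c S := by
  obtain ⟨c, hc⟩ := eval_vertex_eq_sum p hp
  obtain ⟨c₁, c₂, h⟩ := exists_homogeneous_add_mul c hd
  have hz := eq_zero_of_sum_powersetCard_eq_zero_s16 d t univ hd (by simp; omega) c₁
    fun X _ hX => by
      have h1 := h X
      rw [← hc, h0 X hX, hX, sub_self, zero_mul, add_zero] at h1
      exact h1.symm
  refine ⟨c₂, fun X => ?_⟩
  rw [hc, h, sum_eq_zero fun S hS => hz S (subset_univ S) (mem_powersetCard.1 hS).2, zero_add]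

/-- Common powers of `t - ∑ x_i` can be split off a family of polynomials of degree at most `t`
until some member is nonzero somewhere on the `t`-th slice. -/
lemma exists_pow_mul_nonvanishing {n t d : ℕ} (hd : d ≤ t) (ht : 2 * t ≤ n) {ι : Type*}
    (p : ι → MvPolynomial (Fin n) ℝ) (hp : ∀ j, (p j).totalDegree ≤ d)
    (hne : ∃ j X, MvPolynomial.eval (vertex X) (p j) ≠ 0) :
    ∃ (a : ℕ) (g : ι → MvPolynomial (Fin n) ℝ), a ≤ d ∧ (∀ j, (g j).totalDegree ≤ d - a) ∧
      (∀ j X, MvPolynomial.eval (vertex X) (p j) =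
        ((t : ℝ) - X.card) ^ a * MvPolynomial.eval (vertex X) (g j)) ∧
      ∃ j X, X.card = t ∧ MvPolynomial.eval (vertex X) (g j) ≠ 0 := by
  induction d generalizing p with
  | zero =>
    refine ⟨0, p, le_rfl, hp, by simp, ?_⟩
    by_contra! hcon
    obtain ⟨j, X, hX⟩ := hne
    obtain ⟨c, hc⟩ := eval_vertex_of_vanish hd ht (p j) (hp j) (hcon j)
    exact hX (by simp [hc])
  | succ d ih =>
    by_cases hcon : ∃ j X, X.card = t ∧ MvPolynomial.eval (vertex X) (p j) ≠ 0
    · exact ⟨0, p, Nat.zero_le _, hp, by simp, hcon⟩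
    · push Not at hcon
      have hdiv : ∀ j, ∃ g : MvPolynomial (Fin n) ℝ, g.totalDegree ≤ d ∧ ∀ X,
          MvPolynomial.eval (vertex X) (p j) =
            ((t : ℝ) - X.card) * MvPolynomial.eval (vertex X) g := by
        intro j
        obtain ⟨c, hc⟩ := eval_vertex_of_vanish hd ht (p j) (hp j) (hcon j)
        obtain ⟨g, hg, hgc⟩ := exists_eval_vertex_eq d c
        exact ⟨g, hg, fun X => by rw [hc, hgc]⟩
      choose g hg hgp using hdiv
      obtain ⟨j, X, hX⟩ := hne
      obtain ⟨a, g', ha, hg', hgg', hnv⟩ := ih (by omega) g hg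
        ⟨j, X, fun h0 => hX (by rw [hgp, h0, mul_zero])⟩
      refine ⟨a + 1, g', by omega, fun j => by simpa using hg' j, fun j X => ?_, hnv⟩
      rw [hgp, hgg', pow_succ]
      ring

open Finset in
lemma exists_coeff_of_card_invariant {n d : ℕ} (φ : ℕ → ℝ) (c : Finset (Fin n) → ℝ)
    (h : ∀ X : Finset (Fin n), φ #X = ∑ k ∈ range (d + 1), ∑ S ∈ X.powersetCard k, c S) (k : ℕ)
    (hk : k ≤ d) :
    ∃ a : ℝ, ∀ S : Finset (Fin n), #S = k → c S = a := by
  induction k using Nat.strong_induction_on with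
  | _ k ih =>
    choose! a ha using fun (j : ℕ) (hj : j < k) => ih j hj (by omega)
    refine ⟨φ k - ∑ j ∈ range k, (k.choose j : ℝ) * a j, fun S hS => ?_⟩
    have h1 := h S
    rw [← sum_subset (range_mono (Nat.succ_le_succ hk)) fun j _ hj => by
      rw [powersetCard_eq_empty.2 (by simp at hj; omega), sum_empty], sum_range_succ,
      ← hS, powersetCard_self, sum_singleton, hS] at h1
    rw [h1, sum_congr rfl (g := fun j => (k.choose j : ℝ) * a j) fun j hj => by
      rw [sum_congr rfl fun A hA => ha j (mem_range.1 hj) A (mem_powersetCard.1 hA).2, sum_const,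
        card_powersetCard, hS, nsmul_eq_mul]]
    ring

open Finset in
/-- A symmetric polynomial function on the cube is a univariate polynomial in `∑ x_i`. -/
lemma exists_univariate {n d : ℕ} (f : (Fin n → ℝ) → ℝ) (hf : SymmOn n (cube n) f)
    (p : MvPolynomial (Fin n) ℝ) (hp : p.totalDegree ≤ d)
    (hpf : ∀ x ∈ cube n, MvPolynomial.eval x p = f x) :
    ∃ H : Polynomial ℝ, H.natDegree ≤ d ∧ ∀ x ∈ cube n, f x = H.eval (∑ i, x i) := by
  obtain ⟨c, hc⟩ := eval_vertex_eq_sum p hp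
  have hcard : ∀ X Y : Finset (Fin n), #X = #Y → f (vertex X) = f (vertex Y) := by
    intro X Y hXY
    obtain ⟨σ, hσ⟩ := exists_perm_vertex hXY
    rw [← hσ, hf σ _ (vertex_mem_cube Y)]
  obtain ⟨φ, hφ⟩ : ∃ φ : ℕ → ℝ, ∀ X : Finset (Fin n), φ #X = f (vertex X) := by
    classical
    refine ⟨fun k => if h : ∃ X : Finset (Fin n), #X = k then f (vertex h.choose) else 0,
      fun X => ?_⟩
    have hX : ∃ Y : Finset (Fin n), #Y = #X := ⟨X, rfl⟩
    exact (dif_pos hX).trans (hcard _ _ hX.choose_spec)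
  choose! a ha using exists_coeff_of_card_invariant φ c
    fun X => by rw [hφ, ← hpf _ (vertex_mem_cube X), hc]
  refine ⟨∑ k ∈ range (d + 1), Polynomial.C (a k / k.factorial) * descPochhammer ℝ k, ?_, ?_⟩
  · refine Polynomial.natDegree_sum_le_of_forall_le _ _ fun k hk => ?_
    refine (Polynomial.natDegree_C_mul_le _ _).trans ?_
    rw [descPochhammer_natDegree]
    exact Nat.lt_succ_iff.1 (mem_range.1 hk)
  · intro x hx
    obtain ⟨X, rfl⟩ := exists_vertex_eq hx
    rw [← hpf _ hx, hc, sum_vertex, Polynomial.eval_finsetSum]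
    refine sum_congr rfl fun k hk => ?_
    rw [sum_congr rfl fun S hS => ha k (Nat.lt_succ_iff.1 (mem_range.1 hk)) S
      (mem_powersetCard.1 hS).2, sum_const, card_powersetCard, nsmul_eq_mul, Polynomial.eval_mul,
      Polynomial.eval_C, descPochhammer_eval_eq_descFactorial,
      Nat.descFactorial_eq_factorial_mul_choose]
    push_cast
    have : (k.factorial : ℝ) ≠ 0 := by exact_mod_cast k.factorial_ne_zero
    field_simp

lemma degOn_le_natDegree {n : ℕ} (f : (Fin n → ℝ) → ℝ) (H : Polynomial ℝ)
    (hH : ∀ x ∈ cube n, f x = H.eval (∑ i, x i)) : degOn n (cube n) f ≤ H.natDegree := by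
  refine Nat.sInf_le ⟨Polynomial.aeval (∑ i, MvPolynomial.X i) H, ?_, fun x hx => ?_⟩
  · rw [Polynomial.aeval_eq_sum_range]
    refine MvPolynomial.totalDegree_finsetSum_le fun k hk => ?_
    refine (MvPolynomial.totalDegree_smul_le _ _).trans ((MvPolynomial.totalDegree_pow _ _).trans ?_)
    have h1 : (∑ i : Fin n, MvPolynomial.X i : MvPolynomial (Fin n) ℝ).totalDegree ≤ 1 :=
      MvPolynomial.totalDegree_finsetSum_le fun i _ => (MvPolynomial.totalDegree_X i).le
    have h2 : k ≤ H.natDegree := Nat.lt_succ_iff.1 (Finset.mem_range.1 hk)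
    calc k * _ ≤ k * 1 := Nat.mul_le_mul_left k h1
      _ ≤ H.natDegree := by omega
  · rw [hH x hx, Polynomial.aeval_def, Polynomial.hom_eval₂, Polynomial.eval, map_sum]
    simp only [MvPolynomial.eval_X]
    congr 1
    ext r
    simp

lemma exists_univariate_natDegree_eq {n d : ℕ} (f : (Fin n → ℝ) → ℝ)
    (hf : SymmOn n (cube n) f) (p : MvPolynomial (Fin n) ℝ) (hp : p.totalDegree ≤ d)
    (hpf : ∀ x ∈ cube n, MvPolynomial.eval x p = f x) :
    ∃ H : Polynomial ℝ, H.natDegree = degOn n (cube n) f ∧ H.natDegree ≤ d ∧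
      ∀ x ∈ cube n, f x = H.eval (∑ i, x i) := by
  obtain ⟨p', hp', hpf'⟩ := Nat.sInf_mem
    (s := {d | ∃ p : MvPolynomial (Fin n) ℝ, p.totalDegree ≤ d ∧
      ∀ x ∈ cube n, MvPolynomial.eval x p = f x}) ⟨d, p, hp, hpf⟩
  obtain ⟨H, hH, hHf⟩ := exists_univariate f hf p' hp' hpf'
  have hle : degOn n (cube n) f ≤ d := Nat.sInf_le ⟨p, hp, hpf⟩
  exact ⟨H, le_antisymm hH (degOn_le_natDegree f H hHf), hH.trans hle, hHf⟩

lemma degOn_eq_add_of_eq_pow_mul {n t a : ℕ} (h q : (Fin n → ℝ) → ℝ)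
    (hsym : SymmOn n (cube n) h) (qsym : SymmOn n (cube n) q)
    (hne : ∃ x ∈ cube n, h x ≠ 0) (p r : MvPolynomial (Fin n) ℝ)
    (hp : p.totalDegree ≤ n) (hph : ∀ x ∈ cube n, MvPolynomial.eval x p = h x)
    (hr : r.totalDegree + 2 * a ≤ n) (hrq : ∀ x ∈ cube n, MvPolynomial.eval x r = q x)
    (hq : ∀ x ∈ cube n, h x = ((t : ℝ) - ∑ i, x i) ^ (2 * a) * q x) :
    degOn n (cube n) h = degOn n (cube n) q + 2 * a := by
  obtain ⟨H, hH, hHn, hHf⟩ := exists_univariate_natDegree_eq h hsym p hp hph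
  obtain ⟨Q, hQ, hQn, hQf⟩ := exists_univariate_natDegree_eq q qsym r le_rfl hrq
  have hL : ((Polynomial.C (t : ℝ) - Polynomial.X) ^ (2 * a)).natDegree = 2 * a := by
    rw [Polynomial.natDegree_pow, ← neg_sub, Polynomial.natDegree_neg,
      Polynomial.natDegree_X_sub_C, mul_one]
  have hLne : (Polynomial.C (t : ℝ) - Polynomial.X) ^ (2 * a) ≠ 0 := by
    refine pow_ne_zero _ ?_
    rw [← neg_sub]
    exact neg_ne_zero.2 (Polynomial.X_sub_C_ne_zero _)
  have hprod : H = (Polynomial.C (t : ℝ) - Polynomial.X) ^ (2 * a) * Q := by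
    refine Polynomial.eq_of_natDegree_lt_card_of_eval_eq' _ _
      ((Finset.range (n + 1)).map ⟨fun k : ℕ => (k : ℝ), Nat.cast_injective⟩) ?_ ?_
    · intro y hy
      obtain ⟨k, hk, rfl⟩ := Finset.mem_map.1 hy
      obtain ⟨X, -, hX⟩ := Finset.exists_subset_card_eq (s := (Finset.univ : Finset (Fin n)))
        (n := k) (by simpa [Nat.lt_succ_iff] using hk)
      have h1 := hq _ (vertex_mem_cube X)
      rw [hHf _ (vertex_mem_cube X), hQf _ (vertex_mem_cube X), sum_vertex, hX] at h1
      simpa using h1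
    · rw [Finset.card_map, Finset.card_range, Nat.lt_succ_iff, max_le_iff]
      exact ⟨hHn, Polynomial.natDegree_mul_le.trans (by omega)⟩
  have hQne : Q ≠ 0 := by
    rintro rfl
    obtain ⟨x, hx, hx0⟩ := hne
    exact hx0 (by rw [hHf x hx, hprod, mul_zero, Polynomial.eval_zero])
  rw [← hH, ← hQ, hprod, Polynomial.natDegree_mul hLne hQne, hL, add_comm]

theorem stmt16 (n t : ℕ) (ht : 2 * t ≤ n) (h : (Fin n → ℝ) → ℝ)
    (hsym : SymmOn n (cube n) h) (hne : ∃ x ∈ cube n, h x ≠ 0)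
    (m : ℕ) (hs : Fin m → MvPolynomial (Fin n) ℝ)
    (hdeg : ∀ j, (hs j).totalDegree ≤ t)
    (hsos : ∀ x ∈ cube n, h x = ∑ j, (MvPolynomial.eval x (hs j)) ^ 2) :
    ∃ (a : ℕ) (q : (Fin n → ℝ) → ℝ), SymmOn n (cube n) q ∧
      (∀ x ∈ cube n, (∑ i, x i) = (t : ℝ) → 0 < q x) ∧
      (∀ x ∈ cube n, h x = ((t : ℝ) - ∑ i, x i) ^ (2 * a) * q x) ∧
      degOn n (cube n) h = degOn n (cube n) q + 2 * a := by
  have sos_degree : ∀ (g : Fin m → MvPolynomial (Fin n) ℝ) (d : ℕ), (∀ j, (g j).totalDegree ≤ d) →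
      (∑ j, g j ^ 2).totalDegree ≤ 2 * d := fun g d hg =>
    MvPolynomial.totalDegree_finsetSum_le fun j _ =>
      (MvPolynomial.totalDegree_pow _ _).trans (Nat.mul_le_mul_left 2 (hg j))
  have hne' : ∃ j X, MvPolynomial.eval (vertex X) (hs j) ≠ 0 := by
    by_contra! hcon
    obtain ⟨x, hx, hx0⟩ := hne
    obtain ⟨X, rfl⟩ := exists_vertex_eq hx
    exact hx0 (by simp [hsos _ hx, hcon])
  obtain ⟨a, g, hat, hg, hfac, j₀, X₀, hX₀, hgX₀⟩ :=
    exists_pow_mul_nonvanishing le_rfl ht hs hdeg hne'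
  let r : MvPolynomial (Fin n) ℝ := ∑ j, g j ^ 2
  have hr_nonneg : ∀ x, 0 ≤ MvPolynomial.eval x r := fun x => by
    simp only [r, map_sum, map_pow]
    positivity
  have hr_fac : ∀ x ∈ cube n,
      h x = ((t : ℝ) - ∑ i, x i) ^ (2 * a) * MvPolynomial.eval x r := by
    intro x hx
    obtain ⟨X, rfl⟩ := exists_vertex_eq hx
    simp only [r, hsos _ hx, hfac, map_sum, map_pow, Finset.mul_sum, sum_vertex]
    exact Finset.sum_congr rfl fun j _ => by ring
  -- symmetrize the cofactor
  let s : MvPolynomial (Fin n) ℝ :=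
    MvPolynomial.C ((n.factorial : ℝ)⁻¹) * ∑ σ : Equiv.Perm (Fin n), MvPolynomial.rename σ r
  have hs_eval : ∀ x, MvPolynomial.eval x s = (n.factorial : ℝ)⁻¹ *
      ∑ σ : Equiv.Perm (Fin n), MvPolynomial.eval (fun i => x (σ i)) r := fun x => by
    simp only [s, map_mul, map_sum, MvPolynomial.eval_C, MvPolynomial.eval_rename]
    rfl
  have hfact : (0 : ℝ) < n.factorial := by exact_mod_cast n.factorial_pos
  have hs_symm : SymmOn n (cube n) fun x => MvPolynomial.eval x s := by
    intro τ x _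
    simp only [hs_eval]
    congr 1
    exact Fintype.sum_equiv (Equiv.mulLeft τ) _ _ fun σ => rfl
  have hs_fac : ∀ x ∈ cube n,
      h x = ((t : ℝ) - ∑ i, x i) ^ (2 * a) * MvPolynomial.eval x s := by
    intro x hx
    have key : ∀ σ : Equiv.Perm (Fin n), ((t : ℝ) - ∑ i, x i) ^ (2 * a) *
        MvPolynomial.eval (fun i => x (σ i)) r = h x := by
      intro σ
      rw [← hsym σ x hx, hr_fac _ (comp_perm_mem_cube hx σ), Equiv.sum_comp σ x]
    rw [hs_eval, mul_left_comm, Finset.mul_sum, Finset.sum_congr rfl fun σ _ => key σ,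
      Finset.sum_const, Finset.card_univ, Fintype.card_perm, Fintype.card_fin, nsmul_eq_mul,
      inv_mul_cancel_left₀ hfact.ne']
  have hs_degree : s.totalDegree ≤ 2 * (t - a) := by
    refine (MvPolynomial.totalDegree_mul _ _).trans ?_
    rw [MvPolynomial.totalDegree_C, zero_add]
    exact MvPolynomial.totalDegree_finsetSum_le fun σ _ =>
      (MvPolynomial.totalDegree_rename_le _ _).trans (sos_degree g _ hg)
  refine ⟨a, fun x => MvPolynomial.eval x s, hs_symm, ?_, hs_fac, ?_⟩
  · intro x hx hxt
    obtain ⟨X, rfl⟩ := exists_vertex_eq hx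
    rw [sum_vertex] at hxt
    obtain ⟨σ, hσ⟩ := exists_perm_vertex (X := X₀) (Y := X) (by rw [hX₀]; exact_mod_cast hxt.symm)
    beta_reduce
    rw [hs_eval]
    refine mul_pos (inv_pos.2 hfact) (Finset.sum_pos' (fun _ _ => hr_nonneg _)
      ⟨σ, Finset.mem_univ _, ?_⟩)
    rw [hσ]
    simp only [r, map_sum, map_pow]
    exact Finset.sum_pos' (fun _ _ => sq_nonneg _) ⟨j₀, Finset.mem_univ _, by positivity⟩
  · exact degOn_eq_add_of_eq_pow_mul h _ hsym hs_symm hne (∑ j, hs j ^ 2) s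
      ((sos_degree hs t hdeg).trans ht) (fun x hx => by simp [hsos x hx]) (by omega)
      (fun _ _ => rfl) hs_fac
end
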